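/- (Bobkov–Götze–Sambale) There exists a universal constant c > 0 (one may take c = 1/(8e)) with the following property. Let ν be a probability measure on ℝⁿ satisfying a logarithmic Sobolev inequality with constant σ² > 0, i.e. Ent_ν(g²) ≤ 2σ² ∫_{ℝⁿ} |∇g|² dν for all smooth bounded g with bounded derivatives. Let d ≥ 1 and let f : ℝⁿ → ℝ be of class C^d with ∫ f dν = 0 and ∫ ∂_{i_1…i_k} f dν = 0 for all k = 1,…,d−1 and all 1 ≤ i_1 ≤ … ≤ i_k ≤ n. Assume (∫ |f^{(d)}|_{HS}² dν)^{1/2} ≤ 1 and |f^{(d)}(x)|_{Op} ≤ 1 for ν-almost every x. Then ∫_{ℝⁿ} exp( (c/σ²) |f|^{2/d} ) dν ≤ 2. -/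

import Mathlib

open MeasureTheory

/-- `i`-th partial derivative of `g : ℝⁿ → ℝ`. -/
noncomputable def pd {n : ℕ} (i : Fin n) (g : (Fin n → ℝ) → ℝ) : (Fin n → ℝ) → ℝ :=
  fun x => fderiv ℝ g x (Pi.single i 1)

/-- Entry `(i 0, …, i (k-1))` of the hyper-matrix `∇^k f` of `k`-th partial derivatives. -/
noncomputable def pder {n : ℕ} (k : ℕ) (f : (Fin n → ℝ) → ℝ) (i : Fin k → Fin n) :
    (Fin n → ℝ) → ℝ :=
  fun x => iteratedFDeriv ℝ k f x (fun j => Pi.single (i j) 1)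

/-- Entropy of a function `h` with respect to a measure `ν`:
`Ent_ν(h) = ∫ h log h dν − (∫ h dν) log(∫ h dν)`. -/
noncomputable def entropy {n : ℕ} (ν : Measure (Fin n → ℝ)) (h : (Fin n → ℝ) → ℝ) : ℝ :=
  (∫ x, h x * Real.log (h x) ∂ν) - (∫ x, h x ∂ν) * Real.log (∫ x, h x ∂ν)

open Filter Topology
open scoped ContDiff

/-- `G` bounds the local Lipschitz constants of `g`: near each point `x`, the function `g` is
`K`-Lipschitz for every `K > G x`. -/
def LocalLipBound {E : Type*} [NormedAddCommGroup E] (g G : E → ℝ) : Prop :=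
  ∀ x K, G x < K → ∃ t ∈ 𝓝 x, ∀ y ∈ t, ∀ z ∈ t, |g y - g z| ≤ K * ‖y - z‖

namespace LocalLipBound

variable {E : Type*} [NormedAddCommGroup E] {g G h H : E → ℝ}

theorem of_contDiffAt {F : Type*} [NormedSpace ℝ E] [NormedAddCommGroup F] [NormedSpace ℝ F]
    {u : E → F} (hu : ∀ x, ContDiffAt ℝ 1 u x) : LocalLipBound (fun x => ‖u x‖)
      (fun x => ‖fderiv ℝ u x‖) := by
  intro x K hK
  have hK0 : 0 ≤ K := (norm_nonneg _).trans hK.le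
  obtain ⟨t, ht, hL⟩ := ((hu x).hasStrictFDerivAt one_ne_zero).exists_lipschitzOnWith_of_nnnorm_lt
    ⟨K, hK0⟩ hK
  exact ⟨t, ht, fun y hy z hz =>
    (abs_norm_sub_norm_le _ _).trans (hL.norm_sub_le hy hz)⟩

theorem of_contDiffAt_real [NormedSpace ℝ E] {u : E → ℝ} (hu : ∀ x, ContDiffAt ℝ 1 u x) :
    LocalLipBound u (fun x => ‖fderiv ℝ u x‖) := by
  intro x K hK
  have hK0 : 0 ≤ K := (norm_nonneg _).trans hK.le
  obtain ⟨t, ht, hL⟩ := ((hu x).hasStrictFDerivAt one_ne_zero).exists_lipschitzOnWith_of_nnnorm_lt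
    ⟨K, hK0⟩ hK
  exact ⟨t, ht, fun y hy z hz => hL.norm_sub_le hy hz⟩

theorem mono (hg : LocalLipBound g G) (hGH : ∀ x, G x ≤ H x) : LocalLipBound g H :=
  fun x K hK => hg x K ((hGH x).trans_lt hK)

theorem of_abs_sub_le (hg : LocalLipBound g G) (hh : ∀ y z, |h y - h z| ≤ |g y - g z|) :
    LocalLipBound h G := fun x K hK => by
  obtain ⟨t, ht, hL⟩ := hg x K hK
  exact ⟨t, ht, fun y hy z hz => (hh y z).trans (hL y hy z hz)⟩

theorem comp {φ : ℝ → ℝ} {φ' : ℝ → ℝ} (hg : LocalLipBound g G) (hc : Continuous g)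
    (hφ : ∀ x, ContDiffAt ℝ 1 φ (g x))
    (hφ' : ∀ x, HasDerivAt φ (φ' (g x)) (g x)) :
    LocalLipBound (fun x => φ (g x)) (fun x => |φ' (g x)| * G x) := by
  intro x K hK
  obtain ⟨ε, hε, hεK⟩ : ∃ ε > 0, (|φ' (g x)| + ε) * (G x + ε) < K := by
    have : Tendsto (fun ε : ℝ => (|φ' (g x)| + ε) * (G x + ε)) (𝓝[>] 0)
        (𝓝 ((|φ' (g x)| + 0) * (G x + 0))) := by
      apply Tendsto.mono_left _ nhdsWithin_le_nhds
      exact Continuous.tendsto (by fun_prop) 0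
    rw [add_zero, add_zero] at this
    obtain ⟨ε, h1, h2⟩ := ((this.eventually (gt_mem_nhds hK)).and self_mem_nhdsWithin).exists
    exact ⟨ε, h2, h1⟩
  obtain ⟨t, ht, hL⟩ := hg x (G x + ε) (by linarith)
  obtain ⟨s, hs, hM⟩ := (hφ x).exists_lipschitzOnWith_of_nnnorm_lt
    ⟨|φ' (g x)| + ε, by positivity⟩ (by
      change ‖fderiv ℝ φ (g x)‖ < |φ' (g x)| + ε
      rw [(hφ' x).hasFDerivAt.fderiv]
      simpa using hε)
  refine ⟨t ∩ g ⁻¹' s, inter_mem ht (hc.continuousAt hs), fun y hy z hz => ?_⟩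
  calc |φ (g y) - φ (g z)| ≤ (|φ' (g x)| + ε) * |g y - g z| := hM.norm_sub_le hy.2 hz.2
    _ ≤ (|φ' (g x)| + ε) * ((G x + ε) * ‖y - z‖) := by gcongr; exact hL y hy.1 z hz.1
    _ = (|φ' (g x)| + ε) * (G x + ε) * ‖y - z‖ := by ring
    _ ≤ K * ‖y - z‖ := by gcongr

theorem mul_of_bounded {M L : ℝ} (hg : LocalLipBound g G) (hM : ∀ x, |g x| ≤ M)
    (hh1 : ∀ x, |h x| ≤ 1) (hh : ∀ y z, |h y - h z| ≤ L * ‖y - z‖) :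
    LocalLipBound (fun x => g x * h x) (fun x => G x + M * L) := by
  intro x K hK
  obtain ⟨t, ht, hL⟩ := hg x (K - M * L) (by linarith)
  refine ⟨t, ht, fun y hy z hz => ?_⟩
  have hM0 : 0 ≤ M := (abs_nonneg _).trans (hM x)
  calc |g y * h y - g z * h z| = |(g y - g z) * h y + g z * (h y - h z)| := by ring_nf
    _ ≤ |g y - g z| * |h y| + |g z| * |h y - h z| := by
      rw [← abs_mul, ← abs_mul]; exact abs_add_le _ _
    _ ≤ ((K - M * L) * ‖y - z‖) * 1 + M * (L * ‖y - z‖) := by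
      have h1 := hL y hy z hz
      have : 0 ≤ (K - M * L) * ‖y - z‖ := (abs_nonneg _).trans h1
      gcongr
      · exact hh1 y
      · exact hM z
      · exact hh y z
    _ = K * ‖y - z‖ := by ring

theorem continuous (hg : LocalLipBound g G) : Continuous g := by
  rw [continuous_iff_continuousAt]
  intro x
  obtain ⟨t, ht, hL⟩ := hg x (G x + 1) (by linarith)
  rw [ContinuousAt, tendsto_iff_dist_tendsto_zero]
  refine squeeze_zero' (g := fun y => (G x + 1) * ‖y - x‖) (.of_forall fun _ => dist_nonneg) ?_ ?_
  · filter_upwards [ht] with y hy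
    exact hL y hy x (mem_of_mem_nhds ht)
  · have : Continuous fun y : E => (G x + 1) * ‖y - x‖ := by fun_prop
    simpa using this.tendsto x

/-- A function which is locally `K`-Lipschitz near every point of a normed space is globally
`K`-Lipschitz. -/
theorem abs_sub_le [NormedSpace ℝ E] {K : ℝ} (hg : LocalLipBound g fun _ => K) (y z : E) :
    |g y - g z| ≤ K * ‖y - z‖ := by
  set γ : ℝ → E := fun t => z + t • (y - z)
  have hγ : Continuous γ := by fun_prop
  have hγd (s t : ℝ) : ‖γ s - γ t‖ = |s - t| * ‖y - z‖ := by
    simp only [γ, add_sub_add_left_eq_sub, ← sub_smul, norm_smul, Real.norm_eq_abs]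
  have key := image_le_of_liminf_slope_right_le_deriv_boundary
    (f := fun t => |g (γ t) - g z|) (a := 0) (b := 1) (B := fun t => K * ‖y - z‖ * t)
    (B' := fun t => K * ‖y - z‖ * 1)
    (((hg.continuous.comp hγ).sub continuous_const).abs.continuousOn)
    (by simp [γ]) (by fun_prop)
    (fun x _ => ((hasDerivAt_id x).const_mul _).hasDerivWithinAt) (by
      intro x _ r hr
      rw [mul_one] at hr
      obtain ⟨ε, hε, hεr⟩ : ∃ ε > 0, (K + ε) * ‖y - z‖ < r := by
        have : Tendsto (fun ε : ℝ => (K + ε) * ‖y - z‖) (𝓝[>] 0) (𝓝 ((K + 0) * ‖y - z‖)) :=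
          Tendsto.mono_left (Continuous.tendsto (by fun_prop) 0) nhdsWithin_le_nhds
        rw [add_zero] at this
        obtain ⟨ε, h1, h2⟩ := ((this.eventually (gt_mem_nhds hr)).and self_mem_nhdsWithin).exists
        exact ⟨ε, h2, h1⟩
      obtain ⟨t, ht, hL⟩ := hg (γ x) (K + ε) (by linarith)
      apply Eventually.frequently
      filter_upwards [nhdsWithin_le_nhds (hγ.continuousAt.preimage_mem_nhds ht),
        self_mem_nhdsWithin] with s hs hxs
      have hxs : x < s := hxs
      rw [slope_def_field, div_lt_iff₀ (by linarith)]
      calc |g (γ s) - g z| - |g (γ x) - g z| ≤ |g (γ s) - g (γ x)| := by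
            have := abs_sub_abs_le_abs_sub (g (γ s) - g z) (g (γ x) - g z)
            simpa using this
        _ ≤ (K + ε) * ‖γ s - γ x‖ := hL _ hs _ (mem_of_mem_nhds ht)
        _ = (K + ε) * ‖y - z‖ * (s - x) := by
          rw [hγd, abs_of_pos (by linarith)]; ring
        _ < r * (s - x) := by gcongr)
    (x := 1) (by simp)
  simpa [γ] using key

end LocalLipBound

/-- Entropy of `h` with respect to a measure on an arbitrary measurable space. -/
noncomputable def relEntropy {Ω : Type*} [MeasurableSpace Ω] (ν : Measure Ω) (h : Ω → ℝ) : ℝ :=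
  (∫ x, h x * Real.log (h x) ∂ν) - (∫ x, h x ∂ν) * Real.log (∫ x, h x ∂ν)

/-- Logarithmic Sobolev inequality with constant `s` for smooth bounded functions with bounded
derivatives. -/
def LogSobolev {E : Type*} [NormedAddCommGroup E] [NormedSpace ℝ E] [MeasurableSpace E]
    (ν : Measure E) (s : ℝ) : Prop :=
  ∀ g : E → ℝ, ContDiff ℝ ∞ g → (∃ M, ∀ x, |g x| ≤ M) → (∃ M, ∀ x, ‖fderiv ℝ g x‖ ≤ M) →
    relEntropy ν (fun x => g x ^ 2) ≤ 2 * s * ∫ x, ‖fderiv ℝ g x‖ ^ 2 ∂ν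

/-- Entropy is continuous along bounded pointwise convergent sequences. -/
theorem tendsto_relEntropy_sq {Ω : Type*} [MeasurableSpace Ω] {ν : Measure Ω}
    [IsFiniteMeasure ν] {u : ℕ → Ω → ℝ} {g : Ω → ℝ} {M : ℝ}
    (hu : ∀ m, AEStronglyMeasurable (u m) ν) (hM : ∀ m x, |u m x| ≤ M)
    (hlim : ∀ x, Tendsto (fun m => u m x) atTop (𝓝 (g x))) :
    Tendsto (fun m => relEntropy ν (fun x => u m x ^ 2)) atTop
      (𝓝 (relEntropy ν (fun x => g x ^ 2))) := by
  have hmem (m : ℕ) (x : Ω) : u m x ^ 2 ∈ Set.Icc 0 (M ^ 2) :=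
    ⟨sq_nonneg _, sq_le_sq.2 ((hM m x).trans (le_abs_self M))⟩
  obtain ⟨C, hC⟩ := isCompact_Icc.exists_bound_of_continuousOn (s := Set.Icc 0 (M ^ 2))
    Real.continuous_mul_log.continuousOn
  have h1 : Tendsto (fun m => ∫ x, u m x ^ 2 ∂ν) atTop (𝓝 (∫ x, g x ^ 2 ∂ν)) :=
    tendsto_integral_of_dominated_convergence (fun _ => M ^ 2) (fun m => (hu m).pow 2)
      (integrable_const _) (fun m => .of_forall fun x => by
        rw [Real.norm_of_nonneg (sq_nonneg _)]; exact (hmem m x).2)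
      (.of_forall fun x => (hlim x).pow 2)
  have h2 : Tendsto (fun m => ∫ x, u m x ^ 2 * Real.log (u m x ^ 2) ∂ν) atTop
      (𝓝 (∫ x, g x ^ 2 * Real.log (g x ^ 2) ∂ν)) :=
    tendsto_integral_of_dominated_convergence (fun _ => C)
      (fun m => Real.continuous_mul_log.comp_aestronglyMeasurable ((hu m).pow 2))
      (integrable_const _) (fun m => .of_forall fun x => hC _ (hmem m x))
      (.of_forall fun x => (Real.continuous_mul_log.tendsto _).comp ((hlim x).pow 2))
  exact h2.sub ((Real.continuous_mul_log.tendsto _).comp h1)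

section Mollify

variable {E : Type*} [NormedAddCommGroup E] [NormedSpace ℝ E] [FiniteDimensional ℝ E]
  [MeasurableSpace E] [BorelSpace E] {g G : E → ℝ} {K M : ℝ}

open scoped Convolution in
theorem ContDiffBump.abs_convolution_sub_le (φ : ContDiffBump (0 : E)) (hg : Continuous g)
    {r : ℝ} {x y : E} {A : ℝ} (hr : φ.rOut ≤ r)
    (hL : ∀ t ∈ Metric.ball (0 : E) r, |g (y - t) - g (x - t)| ≤ A) :
    |(φ.normed Measure.addHaar ⋆[ContinuousLinearMap.lsmul ℝ ℝ, Measure.addHaar] g) y -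
      (φ.normed Measure.addHaar ⋆[ContinuousLinearMap.lsmul ℝ ℝ, Measure.addHaar] g) x| ≤ A := by
  set μ : Measure E := Measure.addHaar
  have hφc : Continuous (φ.normed μ) := φ.continuous_normed
  have hφs : HasCompactSupport (φ.normed μ) := φ.hasCompactSupport_normed
  have hint (z : E) : Integrable (fun t => φ.normed μ t * g (z - t)) μ :=
    (hφc.mul (by fun_prop)).integrable_of_hasCompactSupport hφs.mul_right
  simp only [convolution_def, ContinuousLinearMap.lsmul_apply, smul_eq_mul]
  rw [← integral_sub (hint y) (hint x)]
  calc |∫ t, (φ.normed μ t * g (y - t) - φ.normed μ t * g (x - t)) ∂μ|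
      ≤ ∫ t, φ.normed μ t * A ∂μ := by
        rw [← Real.norm_eq_abs]
        have hφi : Integrable (φ.normed μ) μ := φ.integrable_normed
        refine norm_integral_le_of_norm_le (hφi.mul_const A) (.of_forall fun t => ?_)
        rw [← mul_sub, norm_mul, Real.norm_of_nonneg (φ.nonneg_normed t)]
        by_cases ht : t ∈ Metric.ball (0 : E) φ.rOut
        · exact mul_le_mul_of_nonneg_left (hL t (Metric.ball_subset_ball hr ht))
            (φ.nonneg_normed t)
        · rw [← φ.support_normed_eq (μ := μ), Function.notMem_support] at ht
          simp [ht]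
    _ = A := by rw [integral_mul_const, φ.integral_normed, one_mul]

open scoped Convolution in
/-- Mollification of a Lipschitz function, with pointwise control of the derivatives. -/
theorem LocalLipBound.exists_smooth_approx (hg : LocalLipBound g G) (hG : ∀ x, 0 ≤ G x)
    (hK0 : 0 ≤ K) (hK : ∀ y z, |g y - g z| ≤ K * ‖y - z‖) :
    ∃ u : ℕ → E → ℝ, (∀ m, ContDiff ℝ ∞ (u m)) ∧ (∀ m x, |u m x - g x| ≤ K) ∧
      (∀ m x, ‖fderiv ℝ (u m) x‖ ≤ K) ∧ (∀ x, Tendsto (fun m => u m x) atTop (𝓝 (g x))) ∧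
      ∀ x, ∀ L > G x, ∀ᶠ m in atTop, ‖fderiv ℝ (u m) x‖ ≤ L := by
  have hr0 (m : ℕ) : 0 < 1 / ((m : ℝ) + 1) := by positivity
  let φ (m : ℕ) : ContDiffBump (0 : E) :=
    { rIn := 1 / ((m : ℝ) + 1) / 2, rOut := 1 / ((m : ℝ) + 1)
      rIn_pos := half_pos (hr0 m), rIn_lt_rOut := half_lt_self (hr0 m) }
  set μ : Measure E := Measure.addHaar
  let u (m : ℕ) : E → ℝ := (φ m).normed μ ⋆[ContinuousLinearMap.lsmul ℝ ℝ, μ] g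
  have hc := hg.continuous
  have hdist (m : ℕ) (x : E) : |u m x - g x| ≤ K * (1 / ((m : ℝ) + 1)) := by
    refine (φ m).dist_normed_convolution_le hc.aestronglyMeasurable fun y hy => ?_
    refine (hK y x).trans ?_
    gcongr
    exact (mem_ball_iff_norm.1 hy).le
  refine ⟨u, fun m => ?_, fun m x => ?_, fun m x => ?_, fun x => ?_, fun x L hL => ?_⟩
  · exact (φ m).hasCompactSupport_normed.contDiff_convolution_left _ (φ m).contDiff_normed
      hc.locallyIntegrable
  · refine (hdist m x).trans (mul_le_of_le_one_right hK0 ?_)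
    rw [div_le_one (by positivity)]
    linarith [(Nat.cast_nonneg m : (0 : ℝ) ≤ m)]
  · refine norm_fderiv_le_of_lip' ℝ hK0 (.of_forall fun y => ?_)
    refine (φ m).abs_convolution_sub_le hc le_rfl fun t _ => (hK _ _).trans (le_of_eq ?_)
    rw [sub_sub_sub_cancel_right]
  · rw [tendsto_iff_dist_tendsto_zero]
    refine squeeze_zero (fun _ => dist_nonneg) (fun m => hdist m x) ?_
    simpa using tendsto_one_div_add_atTop_nhds_zero_nat.const_mul K
  · obtain ⟨t, ht, hLip⟩ := hg x L hL
    obtain ⟨r, hr, hrt⟩ := Metric.mem_nhds_iff.1 ht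
    have hsmall : ∀ᶠ m : ℕ in atTop, 1 / ((m : ℝ) + 1) < r / 2 :=
      tendsto_one_div_add_atTop_nhds_zero_nat.eventually (gt_mem_nhds (half_pos hr))
    filter_upwards [hsmall] with m hm
    refine norm_fderiv_le_of_lip' ℝ ((hG x).trans hL.le) ?_
    filter_upwards [Metric.ball_mem_nhds x (half_pos hr)] with y hy
    refine (φ m).abs_convolution_sub_le hc hm.le fun s hs => ?_
    have hs' : ‖s‖ < r / 2 := by simpa using hs
    have hy' : ‖y - x‖ < r / 2 := mem_ball_iff_norm.1 hy
    refine (hLip _ (hrt ?_) _ (hrt ?_)).trans (le_of_eq ?_)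
    · rw [mem_ball_iff_norm, show y - s - x = (y - x) - s by abel]
      exact (norm_sub_le _ _).trans_lt (by linarith)
    · rw [mem_ball_iff_norm, show x - s - x = -s by abel, norm_neg]
      linarith
    · rw [sub_sub_sub_cancel_right]

variable {ν : Measure E} [IsProbabilityMeasure ν] {s : ℝ}

/-- The logarithmic Sobolev inequality extends to bounded Lipschitz functions. -/
theorem LogSobolev.of_lipschitz (hν : LogSobolev ν s) (hs : 0 ≤ s) (hg : LocalLipBound g G)
    (hG : ∀ x, 0 ≤ G x) (hGc : Measurable G) (hG2 : Integrable (fun x => G x ^ 2) ν)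
    (hM : ∀ x, |g x| ≤ M) (hK0 : 0 ≤ K)
    (hK : ∀ y z, |g y - g z| ≤ K * ‖y - z‖) :
    relEntropy ν (fun x => g x ^ 2) ≤ 2 * s * ∫ x, G x ^ 2 ∂ν := by
  obtain ⟨u, hu, hug, hud, hlim, hlimd⟩ := hg.exists_smooth_approx hG hK0 hK
  have huM (m : ℕ) (x : E) : |u m x| ≤ M + K := by
    have := abs_add_le (u m x - g x) (g x)
    rw [sub_add_cancel] at this
    linarith [hM x, hug m x]
  have hfd (m : ℕ) : Continuous (fun x => ‖fderiv ℝ (u m) x‖) :=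
    ((hu m).continuous_fderiv (by simp)).norm
  have hmax : Tendsto (fun m => ∫ x, max ‖fderiv ℝ (u m) x‖ (G x) ^ 2 ∂ν) atTop
      (𝓝 (∫ x, G x ^ 2 ∂ν)) := by
    refine tendsto_integral_of_dominated_convergence (fun x => K ^ 2 + G x ^ 2)
      (fun m => (((hfd m).measurable.max hGc).pow_const 2).aestronglyMeasurable)
      ((integrable_const _).add hG2) (fun m => .of_forall fun x => ?_) (.of_forall fun x => ?_)
    · rw [Real.norm_of_nonneg (sq_nonneg _)]
      rcases max_cases ‖fderiv ℝ (u m) x‖ (G x) with h | h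
      · rw [h.1]
        have := pow_le_pow_left₀ (norm_nonneg _) (hud m x) 2
        linarith [sq_nonneg (G x)]
      · rw [h.1]; linarith [sq_nonneg K]
    · refine Tendsto.pow ?_ 2
      refine tendsto_order.2 ⟨fun a ha => .of_forall fun m => ha.trans_le (le_max_right _ _),
        fun a ha => ?_⟩
      filter_upwards [hlimd x ((G x + a) / 2) (by linarith)] with m hm
      exact max_lt (by linarith) ha
  refine le_of_tendsto_of_tendsto
    (tendsto_relEntropy_sq (fun m => (hu m).continuous.aestronglyMeasurable) huM hlim)
    (hmax.const_mul (2 * s)) (.of_forall fun m => ?_)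
  refine (hν (u m) (hu m) ⟨_, huM m⟩ ⟨K, hud m⟩).trans ?_
  refine mul_le_mul_of_nonneg_left (integral_mono ?_ ?_ fun x => ?_) (by positivity)
  · refine Integrable.of_bound ((hfd m).pow 2).aestronglyMeasurable (K ^ 2) (.of_forall fun x => ?_)
    rw [Real.norm_of_nonneg (sq_nonneg _)]
    exact pow_le_pow_left₀ (norm_nonneg _) (hud m x) 2
  · refine Integrable.mono' ((integrable_const (K ^ 2)).add hG2)
      (((hfd m).measurable.max hGc).pow_const 2).aestronglyMeasurable (.of_forall fun x => ?_)
    rw [Real.norm_of_nonneg (sq_nonneg _)]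
    rcases max_cases ‖fderiv ℝ (u m) x‖ (G x) with h | h
    · rw [h.1]
      have := pow_le_pow_left₀ (norm_nonneg _) (hud m x) 2
      simp only [Pi.add_apply]
      linarith [sq_nonneg (G x)]
    · rw [h.1]; simp only [Pi.add_apply]; linarith [sq_nonneg K]
  · exact pow_le_pow_left₀ (norm_nonneg _) (le_max_left _ _) 2

/-- The logarithmic Sobolev inequality extends to bounded locally Lipschitz functions. -/
theorem LogSobolev.of_bounded (hν : LogSobolev ν s) (hs : 0 ≤ s) (hg : LocalLipBound g G)
    (hG : ∀ x, 0 ≤ G x) (hGc : Continuous G) (hG2 : MemLp G 2 ν) (hM : ∀ x, |g x| ≤ M) :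
    relEntropy ν (fun x => g x ^ 2) ≤ 2 * s * ∫ x, G x ^ 2 ∂ν := by
  have hM0 : 0 ≤ M := (abs_nonneg _).trans (hM 0)
  let χ (m : ℕ) (x : E) : ℝ := max 0 (min 1 (2 - ‖x‖ / ((m : ℝ) + 1)))
  have hχ0 (m : ℕ) (x : E) : 0 ≤ χ m x := le_max_left _ _
  have hχ1 (m : ℕ) (x : E) : |χ m x| ≤ 1 := by
    rw [abs_of_nonneg (hχ0 m x)]
    exact max_le zero_le_one (min_le_left _ _)
  have hχL (m : ℕ) (y z : E) : |χ m y - χ m z| ≤ (1 / ((m : ℝ) + 1)) * ‖y - z‖ := by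
    calc |χ m y - χ m z| ≤ |min 1 (2 - ‖y‖ / ((m : ℝ) + 1)) - min 1 (2 - ‖z‖ / ((m : ℝ) + 1))| := by
          simpa using abs_max_sub_max_le_max 0 (min 1 (2 - ‖y‖ / ((m : ℝ) + 1))) 0
            (min 1 (2 - ‖z‖ / ((m : ℝ) + 1)))
      _ ≤ |(2 - ‖y‖ / ((m : ℝ) + 1)) - (2 - ‖z‖ / ((m : ℝ) + 1))| := by
          simpa using abs_min_sub_min_le_max 1 (2 - ‖y‖ / ((m : ℝ) + 1)) 1
            (2 - ‖z‖ / ((m : ℝ) + 1))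
      _ = (1 / ((m : ℝ) + 1)) * |‖z‖ - ‖y‖| := by
          have h0 : |1 / ((m : ℝ) + 1)| = 1 / ((m : ℝ) + 1) := abs_of_nonneg (by positivity)
          rw [← h0, ← abs_mul]
          congr 1; ring
      _ ≤ (1 / ((m : ℝ) + 1)) * ‖y - z‖ := by
          gcongr
          rw [abs_sub_comm]
          exact abs_norm_sub_norm_le _ _
  have hχout (m : ℕ) (x : E) (hx : 2 * ((m : ℝ) + 1) ≤ ‖x‖) : χ m x = 0 := by
    refine max_eq_left ((min_le_right _ _).trans ?_)
    rw [sub_nonpos, le_div_iff₀ (by positivity)]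
    exact hx
  have hlim (x : E) : Tendsto (fun m => g x * χ m x) atTop (𝓝 (g x)) := by
    refine tendsto_const_nhds.congr' ?_
    obtain ⟨m₀, hm₀⟩ := exists_nat_ge ‖x‖
    filter_upwards [eventually_ge_atTop m₀] with m hm
    have h1 : ‖x‖ / ((m : ℝ) + 1) ≤ 1 := by
      rw [div_le_one (by positivity)]
      have : (m₀ : ℝ) ≤ m := by exact_mod_cast hm
      linarith
    have : χ m x = 1 := by
      simp only [χ]
      rw [min_eq_left (by linarith), max_eq_right zero_le_one]
    rw [this, mul_one]
  have hbd (m : ℕ) (x : E) : |g x * χ m x| ≤ M := by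
    rw [abs_mul]
    exact (mul_le_of_le_one_right (abs_nonneg _) (hχ1 m x)).trans (hM x)
  have hLB (m : ℕ) :
      LocalLipBound (fun x => g x * χ m x) (fun x => G x + M * (1 / ((m : ℝ) + 1))) :=
    hg.mul_of_bounded hM (hχ1 m) (hχL m)
  have hG2' (c : ℝ) : Integrable (fun x => (G x + c) ^ 2) ν :=
    (hG2.add (memLp_const c)).integrable_sq
  have hm (m : ℕ) : relEntropy ν (fun x => (g x * χ m x) ^ 2) ≤
      2 * s * ∫ x, (G x + M * (1 / ((m : ℝ) + 1))) ^ 2 ∂ν := by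
    have hcomp : IsCompact (Metric.closedBall (0 : E) (2 * ((m : ℝ) + 1))) :=
      isCompact_closedBall _ _
    obtain ⟨C, hC⟩ := hcomp.exists_bound_of_continuousOn
      (f := fun x => G x + M * (1 / ((m : ℝ) + 1))) (by fun_prop)
    have hC0 : 0 ≤ C := (norm_nonneg _).trans (hC 0 (by simp; positivity))
    have hlip : LocalLipBound (fun x => g x * χ m x) (fun _ => C) := by
      intro x L hL
      by_cases hx : ‖x‖ ≤ 2 * ((m : ℝ) + 1)
      · exact hLB m x L (((le_abs_self _).trans (hC x (by simpa using hx))).trans_lt hL)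
      · refine ⟨{y | 2 * ((m : ℝ) + 1) < ‖y‖}, (isOpen_lt continuous_const
          continuous_norm).mem_nhds (not_le.1 hx), fun y hy z hz => ?_⟩
        simp only [hχout m y hy.le, hχout m z hz.le, mul_zero, sub_zero, abs_zero]
        exact mul_nonneg (hC0.trans hL.le) (norm_nonneg _)
    exact hν.of_lipschitz hs (hLB m) (fun x => add_nonneg (hG x) (by positivity))
      (by fun_prop) (hG2' _) (hbd m) hC0 hlip.abs_sub_le
  have hR : Tendsto (fun m : ℕ => 2 * s * ∫ x, (G x + M * (1 / ((m : ℝ) + 1))) ^ 2 ∂ν) atTop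
      (𝓝 (2 * s * ∫ x, G x ^ 2 ∂ν)) := by
    refine Tendsto.const_mul _ ?_
    refine tendsto_integral_of_dominated_convergence (fun x => (G x + M) ^ 2)
      (fun m => Continuous.aestronglyMeasurable (by fun_prop)) (hG2' M)
      (fun m => .of_forall fun x => ?_) (.of_forall fun x => ?_)
    · rw [Real.norm_of_nonneg (sq_nonneg _)]
      have h0 : 0 ≤ M * (1 / ((m : ℝ) + 1)) := by positivity
      have h1 : M * (1 / ((m : ℝ) + 1)) ≤ M := by
        refine mul_le_of_le_one_right hM0 ?_
        rw [div_le_one (by positivity)]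
        linarith [(Nat.cast_nonneg m : (0 : ℝ) ≤ m)]
      exact pow_le_pow_left₀ (add_nonneg (hG x) h0) (by linarith) 2
    · have := (tendsto_one_div_add_atTop_nhds_zero_nat (𝕜 := ℝ)).const_mul M
      simpa using (this.const_add (G x)).pow 2
  exact le_of_tendsto_of_tendsto (tendsto_relEntropy_sq
    (fun m => (hLB m).continuous.aestronglyMeasurable) hbd hlim) hR (.of_forall hm)

end Mollify

theorem sq_mul_log_sq_one_add_ge {u : ℝ} (hu : |u| ≤ 1 / 2) :
    2 * u + 3 * u ^ 2 - 10 * |u| ^ 3 ≤ (1 + u) ^ 2 * Real.log ((1 + u) ^ 2) := by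
  have h := Real.abs_log_sub_add_sum_range_le (x := -u) (by rw [abs_neg]; linarith) 2
  simp only [Finset.sum_range_succ, Finset.sum_range_zero, abs_neg, sub_neg_eq_add] at h
  norm_num at h
  have h2 : |u| ^ 3 / (1 - |u|) ≤ 2 * |u| ^ 3 := by
    rw [div_le_iff₀ (by linarith)]
    nlinarith [pow_nonneg (abs_nonneg u) 3]
  have h3 := (abs_le.1 (h.trans h2)).1
  have hlog : u - u ^ 2 / 2 - 2 * |u| ^ 3 ≤ Real.log (1 + u) := by linarith
  rw [Real.log_pow]
  have hu' := abs_le.1 hu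
  have h4 : u ^ 4 ≤ |u| ^ 3 / 2 := by
    rw [← (show Even 4 by decide).pow_abs]
    nlinarith [pow_nonneg (abs_nonneg u) 3]
  have h5 : (1 + u) ^ 2 ≤ 9 / 4 := by nlinarith
  push_cast
  calc 2 * u + 3 * u ^ 2 - 10 * |u| ^ 3
      ≤ 2 * u + 3 * u ^ 2 - u ^ 4 - 4 * ((1 + u) ^ 2 * |u| ^ 3) := by
        nlinarith [mul_le_mul_of_nonneg_right h5 (pow_nonneg (abs_nonneg u) 3),
          pow_nonneg (abs_nonneg u) 3]
    _ = (1 + u) ^ 2 * (2 * (u - u ^ 2 / 2 - 2 * |u| ^ 3)) := by ring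
    _ ≤ (1 + u) ^ 2 * (2 * Real.log (1 + u)) := by gcongr

section Poincare

variable {E : Type*} [NormedAddCommGroup E] [NormedSpace ℝ E] [FiniteDimensional ℝ E]
  [MeasurableSpace E] [BorelSpace E] {g G : E → ℝ} {M : ℝ}
  {ν : Measure E} [IsProbabilityMeasure ν] {s : ℝ}

theorem LogSobolev.integral_sq_le_of_bounded (hν : LogSobolev ν s) (hs : 0 ≤ s)
    (hg : LocalLipBound g G) (hG : ∀ x, 0 ≤ G x) (hGc : Continuous G) (hG2 : MemLp G 2 ν)
    (hM : ∀ x, |g x| ≤ M) (h0 : ∫ x, g x ∂ν = 0) :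
    ∫ x, g x ^ 2 ∂ν ≤ s * ∫ x, G x ^ 2 ∂ν := by
  have hM0 : 0 ≤ M := (abs_nonneg _).trans (hM 0)
  have hc := hg.continuous
  have hgi : Integrable g ν := .of_bound hc.aestronglyMeasurable M (.of_forall hM)
  have hg2 : Integrable (fun x => g x ^ 2) ν :=
    .of_bound (hc.pow 2).aestronglyMeasurable (M ^ 2) (.of_forall fun x => by
      rw [norm_pow]; exact pow_le_pow_left₀ (norm_nonneg _) (hM x) 2)
  set V := ∫ x, g x ^ 2 ∂ν
  set A := ∫ x, G x ^ 2 ∂ν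
  have hV0 : 0 ≤ V := integral_nonneg fun x => sq_nonneg _
  have hquad (a b c : ℝ) : Integrable (fun x => a + (b * g x + c * g x ^ 2)) ν ∧
      ∫ x, (a + (b * g x + c * g x ^ 2)) ∂ν = a + c * V := by
    have hi : Integrable (fun x => b * g x + c * g x ^ 2) ν :=
      (hgi.const_mul _).add (hg2.const_mul _)
    refine ⟨(integrable_const _).add hi, ?_⟩
    rw [integral_add (integrable_const _) hi, integral_add (hgi.const_mul _) (hg2.const_mul _),
      integral_const_mul, integral_const_mul, h0]
    simp [V]
  have key : ∀ ε ∈ Set.Ioo 0 (1 / (2 * (M + 1))),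
      2 * V ≤ 2 * s * A + 10 * M ^ 3 * ε + V ^ 2 * ε ^ 2 := by
    intro ε ⟨hε, hεM⟩
    have hεg (x : E) : |ε * g x| ≤ 1 / 2 := by
      rw [abs_mul, abs_of_pos hε]
      have h1 : ε * (2 * (M + 1)) < 1 := by
        rwa [lt_div_iff₀ (by positivity)] at hεM
      nlinarith [mul_le_mul_of_nonneg_left (hM x) hε.le]
    have hLB : LocalLipBound (fun x => 1 + ε * g x) (fun x => |ε| * G x) :=
      hg.comp (φ := fun y => 1 + ε * y) (φ' := fun _ => ε) hc (fun x => by fun_prop)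
        (fun x => by simpa using ((hasDerivAt_id (g x)).const_mul ε).const_add 1)
    have hent := hν.of_bounded hs hLB (fun x => mul_nonneg (abs_nonneg _) (hG x)) (by fun_prop)
      (hG2.const_mul _) (M := 3 / 2) (fun x => by
        have := abs_le.1 (hεg x)
        rw [abs_le]; constructor <;> linarith)
    have e1 : ∫ x, (|ε| * G x) ^ 2 ∂ν = ε ^ 2 * A := by
      rw [← integral_const_mul]
      simp_rw [mul_pow, sq_abs]
    have e2 : ∫ x, (1 + ε * g x) ^ 2 ∂ν = 1 + ε ^ 2 * V := by
      have : ∀ x, (1 + ε * g x) ^ 2 = 1 + (2 * ε * g x + ε ^ 2 * g x ^ 2) := fun x => by ring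
      simp_rw [this]
      exact (hquad _ _ _).2
    have e3 : 3 * ε ^ 2 * V - 10 * ε ^ 3 * M ^ 3 ≤
        ∫ x, (1 + ε * g x) ^ 2 * Real.log ((1 + ε * g x) ^ 2) ∂ν := by
      obtain ⟨hi, hI⟩ := hquad (-(10 * ε ^ 3 * M ^ 3)) (2 * ε) (3 * ε ^ 2)
      rw [sub_eq_neg_add, ← hI]
      obtain ⟨C, hC⟩ := isCompact_Icc.exists_bound_of_continuousOn (s := Set.Icc 0 4)
        Real.continuous_mul_log.continuousOn
      refine integral_mono hi
        (.of_bound (C := C) ?_ (.of_forall fun x => hC _ ⟨sq_nonneg _, ?_⟩)) fun x => ?_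
      · exact (Real.continuous_mul_log.comp
          (show Continuous fun x => (1 + ε * g x) ^ 2 by fun_prop)).aestronglyMeasurable
      · have := abs_le.1 (hεg x)
        nlinarith
      · refine le_trans ?_ (sq_mul_log_sq_one_add_ge (hεg x))
        have h3 : |ε * g x| ^ 3 ≤ ε ^ 3 * M ^ 3 := by
          rw [abs_mul, abs_of_pos hε, mul_pow]
          gcongr
          exact hM x
        nlinarith
    have e4 : (1 + ε ^ 2 * V) * Real.log (1 + ε ^ 2 * V) ≤
        (1 + ε ^ 2 * V) * (ε ^ 2 * V) := by
      have hp : 0 < 1 + ε ^ 2 * V := by positivity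
      have := Real.log_le_sub_one_of_pos hp
      exact mul_le_mul_of_nonneg_left (by linarith) hp.le
    rw [relEntropy, e1, e2] at hent
    have h : ε ^ 2 * (2 * V) ≤ ε ^ 2 * (2 * s * A + 10 * M ^ 3 * ε + V ^ 2 * ε ^ 2) := by
      nlinarith
    exact le_of_mul_le_mul_left h (by positivity)
  have hlim : Tendsto (fun ε : ℝ => 2 * s * A + 10 * M ^ 3 * ε + V ^ 2 * ε ^ 2) (𝓝[>] 0)
      (𝓝 (2 * s * A + 10 * M ^ 3 * 0 + V ^ 2 * 0 ^ 2)) :=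
    Tendsto.mono_left (Continuous.tendsto (by fun_prop) 0) nhdsWithin_le_nhds
  have := ge_of_tendsto hlim (eventually_of_mem (Ioo_mem_nhdsGT (by positivity)) key)
  linarith

/-- Fatou property of the `L^p` norm. -/
theorem memLp_of_tendsto {Ω : Type*} [MeasurableSpace Ω] {μ : Measure Ω}
    [IsFiniteMeasure μ] {p : ENNReal} {u : ℕ → Ω → ℝ} {f : Ω → ℝ} {C : ℕ → ℝ} {c : ℝ}
    (hu : ∀ m, MemLp (u m) p μ) (hlim : ∀ x, Tendsto (fun m => u m x) atTop (𝓝 (f x)))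
    (hC : ∀ m, lpNorm (u m) p μ ≤ C m) (hc : Tendsto C atTop (𝓝 c)) :
    MemLp f p μ ∧ lpNorm f p μ ≤ c := by
  have hm : AEStronglyMeasurable f μ :=
    aestronglyMeasurable_of_tendsto_ae atTop (fun m => (hu m).1) (.of_forall hlim)
  have hle : eLpNorm f p μ ≤ ENNReal.ofReal c := by
    refine (Lp.eLpNorm_lim_le_liminf_eLpNorm (fun m => (hu m).1) f (.of_forall hlim)).trans ?_
    rw [← ((ENNReal.continuous_ofReal.tendsto c).comp hc).liminf_eq]
    refine liminf_le_liminf (.of_forall fun m => ?_)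
    rw [← ofReal_lpNorm (hu m)]
    exact ENNReal.ofReal_le_ofReal (hC m)
  refine ⟨⟨hm, hle.trans_lt ENNReal.ofReal_lt_top⟩, ?_⟩
  rw [← toReal_eLpNorm hm]
  exact ENNReal.toReal_le_of_le_ofReal
    (ge_of_tendsto hc (.of_forall fun m => lpNorm_nonneg.trans (hC m))) hle

theorem lpNorm_two_sq {Ω : Type*} [MeasurableSpace Ω] {μ : Measure Ω} {f : Ω → ℝ}
    (hf : AEStronglyMeasurable f μ) : lpNorm f 2 μ ^ 2 = ∫ x, f x ^ 2 ∂μ := by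
  rw [lpNorm_eq_integral_norm_rpow_toReal (by simp) (by simp) hf]
  simp only [ENNReal.toReal_ofNat, Real.rpow_ofNat, Real.norm_eq_abs, sq_abs]
  rw [← one_div, ← Real.sqrt_eq_rpow, Real.sq_sqrt (integral_nonneg fun x => sq_nonneg _)]

/-- A logarithmic Sobolev inequality implies a Poincaré inequality. -/
theorem LogSobolev.poincare (hν : LogSobolev ν s) (hs : 0 ≤ s)
    (hg : LocalLipBound g G) (hG : ∀ x, 0 ≤ G x) (hGc : Continuous G) (hG2 : MemLp G 2 ν) :
    MemLp g 2 ν ∧ (∫ x, g x ∂ν = 0 → ∫ x, g x ^ 2 ∂ν ≤ s * ∫ x, G x ^ 2 ∂ν) := by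
  set A := ∫ x, G x ^ 2 ∂ν
  have hc := hg.continuous
  let T (m : ℕ) (x : E) : ℝ := max (-m) (min m (g x))
  have hTc (m : ℕ) : Continuous (T m) := by fun_prop
  have hTm (m : ℕ) (x : E) : |T m x| ≤ m := by
    have : (0 : ℝ) ≤ m := m.cast_nonneg
    exact abs_le.2 ⟨le_max_left _ _, max_le (by linarith) (min_le_left _ _)⟩
  have hTg (m : ℕ) (x : E) : |T m x| ≤ |g x| := by
    have : (0 : ℝ) ≤ m := m.cast_nonneg
    refine abs_le.2 ⟨le_max_of_le_right (le_min ?_ (neg_abs_le _)), max_le ?_ ?_⟩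
    · linarith [abs_nonneg (g x)]
    · linarith [abs_nonneg (g x)]
    · exact (min_le_right _ _).trans (le_abs_self _)
  have hTL (m : ℕ) (y z : E) : |T m y - T m z| ≤ |g y - g z| := by
    refine (by
      simpa using abs_max_sub_max_le_max (-(m : ℝ)) (min m (g y)) (-m) (min (m : ℝ) (g z)) :
      |T m y - T m z| ≤ |min (m : ℝ) (g y) - min (m : ℝ) (g z)|).trans ?_
    simpa using abs_min_sub_min_le_max (m : ℝ) (g y) m (g z)
  have hTlim (x : E) : Tendsto (fun m => T m x) atTop (𝓝 (g x)) := by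
    refine tendsto_const_nhds.congr' ?_
    obtain ⟨m₀, hm₀⟩ := exists_nat_ge |g x|
    filter_upwards [eventually_ge_atTop m₀] with m hm
    have : |g x| ≤ m := hm₀.trans (by exact_mod_cast hm)
    have := abs_le.1 this
    simp only [T]
    rw [min_eq_right this.2, max_eq_right this.1]
  have hTp (m : ℕ) : MemLp (T m) 2 ν :=
    .of_bound (hTc m).aestronglyMeasurable m (.of_forall (hTm m))
  let a (m : ℕ) : ℝ := ∫ x, T m x ∂ν
  have hvar (m : ℕ) : ∫ x, (T m x - a m) ^ 2 ∂ν ≤ s * A := by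
    refine hν.integral_sq_le_of_bounded hs (hg.of_abs_sub_le fun y z => ?_) hG hGc hG2
      (M := m + |a m|) (fun x => (abs_sub _ _).trans (by linarith [hTm m x])) ?_
    · simpa using hTL m y z
    · rw [integral_sub ((hTp m).integrable one_le_two) (integrable_const _)]
      simp [a]
  have hsub (m : ℕ) : MemLp (fun x => T m x - a m) 2 ν := (hTp m).sub (memLp_const _)
  obtain ⟨k, hk⟩ : ∃ k : ℕ, 0 < ν.real {x | |g x| ≤ k} := by
    by_contra! h
    have hz (k : ℕ) : ν {x | |g x| ≤ k} = 0 := by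
      have := le_antisymm (h k) measureReal_nonneg
      rwa [measureReal_eq_zero_iff] at this
    have huniv : ⋃ k : ℕ, {x | |g x| ≤ k} = Set.univ :=
      Set.eq_univ_of_forall fun x => Set.mem_iUnion.2 (exists_nat_ge |g x|)
    have := measure_iUnion_null hz
    rw [huniv, measure_univ] at this
    exact one_ne_zero this
  set S : Set E := {x | |g x| ≤ k}
  have hS : MeasurableSet S := (isClosed_le hc.abs continuous_const).measurableSet
  have ha (m : ℕ) : a m ^ 2 ≤ (2 * (s * A) + 2 * k ^ 2) / ν.real S := by
    rw [le_div_iff₀ hk]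
    have hi : Integrable (fun x => 2 * (T m x - a m) ^ 2 + 2 * (k : ℝ) ^ 2) ν :=
      ((hsub m).integrable_sq.const_mul 2).add (integrable_const _)
    calc a m ^ 2 * ν.real S = ∫ x in S, a m ^ 2 ∂ν := by simp [mul_comm]
      _ ≤ ∫ x in S, (2 * (T m x - a m) ^ 2 + 2 * (k : ℝ) ^ 2) ∂ν := by
        refine setIntegral_mono_on (integrable_const _) hi.integrableOn hS fun x hx => ?_
        have h1 : |T m x| ≤ k := (hTg m x).trans hx
        have h2 : T m x ^ 2 ≤ (k : ℝ) ^ 2 := sq_le_sq.2 (h1.trans (le_abs_self _))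
        nlinarith [sq_nonneg (2 * T m x - a m)]
      _ ≤ ∫ x, (2 * (T m x - a m) ^ 2 + 2 * (k : ℝ) ^ 2) ∂ν :=
        setIntegral_le_integral hi (.of_forall fun x => by positivity)
      _ ≤ 2 * (s * A) + 2 * (k : ℝ) ^ 2 := by
        rw [integral_add ((hsub m).integrable_sq.const_mul 2) (integrable_const _),
          integral_const_mul]
        simpa using hvar m
  have hT2 (m : ℕ) : lpNorm (T m) 2 ν ≤
      √(2 * (s * A) + 2 * ((2 * (s * A) + 2 * k ^ 2) / ν.real S)) := by
    refine Real.le_sqrt_of_sq_le ?_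
    rw [lpNorm_two_sq (hTp m).1]
    calc ∫ x, T m x ^ 2 ∂ν ≤ ∫ x, (2 * (T m x - a m) ^ 2 + 2 * a m ^ 2) ∂ν :=
          integral_mono (hTp m).integrable_sq
            (((hsub m).integrable_sq.const_mul 2).add (integrable_const _))
            fun x => by nlinarith [sq_nonneg (T m x - 2 * a m)]
      _ = 2 * ∫ x, (T m x - a m) ^ 2 ∂ν + 2 * a m ^ 2 := by
        rw [integral_add ((hsub m).integrable_sq.const_mul 2) (integrable_const _),
          integral_const_mul]
        simp
      _ ≤ _ := by linarith [ha m, hvar m]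
  have hg2 := (memLp_of_tendsto hTp hTlim hT2 tendsto_const_nhds).1
  refine ⟨hg2, fun h0 => ?_⟩
  have halim : Tendsto a atTop (𝓝 0) := by
    rw [← h0]
    exact tendsto_integral_of_dominated_convergence (fun x => |g x|)
      (fun m => (hTc m).aestronglyMeasurable) (hg2.integrable one_le_two).abs
      (fun m => .of_forall (hTg m)) (.of_forall hTlim)
  have hlim (x : E) : Tendsto (fun m => T m x - a m) atTop (𝓝 (g x)) := by
    simpa using (hTlim x).sub halim
  have := (memLp_of_tendsto hsub hlim (C := fun _ => √(s * A)) (fun m =>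
    Real.le_sqrt_of_sq_le (by rw [lpNorm_two_sq (hsub m).1]; exact hvar m)) tendsto_const_nhds).2
  rw [← lpNorm_two_sq hg2.1]
  have hA : 0 ≤ s * A := mul_nonneg hs (integral_nonneg fun x => sq_nonneg _)
  exact (pow_le_pow_left₀ lpNorm_nonneg this 2).trans_eq (Real.sq_sqrt hA)

end Poincare

section Moments

variable {E : Type*} [NormedAddCommGroup E] [NormedSpace ℝ E] [FiniteDimensional ℝ E]
  [MeasurableSpace E] [BorelSpace E] {g G : E → ℝ} {M : ℝ}
  {ν : Measure E} [IsProbabilityMeasure ν] {s : ℝ}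

theorem lpNorm_mono_exponent {Ω : Type*} [MeasurableSpace Ω] {μ : Measure Ω}
    [IsProbabilityMeasure μ] {f : Ω → ℝ} {p q : ENNReal} (hpq : p ≤ q) (hf : MemLp f q μ) :
    lpNorm f p μ ≤ lpNorm f q μ := by
  rw [← toReal_eLpNorm hf.1, ← toReal_eLpNorm hf.1]
  exact ENNReal.toReal_mono hf.2.ne (eLpNorm_le_eLpNorm_of_exponent_le hpq hf.1)

theorem lpNorm_ofReal_eq {Ω : Type*} [MeasurableSpace Ω] {μ : Measure Ω} {f : Ω → ℝ} {p : ℝ}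
    (hp : 0 < p) (hf : AEStronglyMeasurable f μ) :
    lpNorm f (ENNReal.ofReal p) μ = (∫ x, |f x| ^ p ∂μ) ^ (1 / p) := by
  rw [lpNorm_eq_integral_norm_rpow_toReal (by simpa using hp) (by simp) hf,
    ENNReal.toReal_ofReal hp.le, one_div]
  rfl

/-- Entropy bound for the powers of a function bounded away from `0` and `∞`. -/
theorem LogSobolev.relEntropy_exp_le (hν : LogSobolev ν s) (hs : 0 ≤ s)
    (hg : LocalLipBound g G) (hG : ∀ x, 0 ≤ G x) (hGc : Continuous G) {δ q : ℝ} (hδ : 0 < δ)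
    (hgδ : ∀ x, δ ≤ g x) (hM : ∀ x, g x ≤ M) (hq : 2 < q) (hGq : MemLp G (ENNReal.ofReal q) ν) :
    relEntropy ν (fun x => Real.exp (q * Real.log (g x))) ≤ 2 * s * (q ^ 2 / 4 *
      ((∫ x, Real.exp (q * Real.log (g x)) ∂ν) ^ (1 - 2 / q) *
        lpNorm G (ENNReal.ofReal q) ν ^ 2)) := by
  have hc := hg.continuous
  have hpos (x : E) : 0 < g x := hδ.trans_le (hgδ x)
  have hlc : Continuous fun x => Real.log (g x) := hc.log fun x => (hpos x).ne'
  have hbd (r : ℝ) : ∃ C, ∀ x, ‖Real.exp (r * Real.log (g x))‖ ≤ C := by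
    obtain ⟨C, hC⟩ := isCompact_Icc.exists_bound_of_continuousOn (s := Set.Icc δ M)
      (f := fun y => Real.exp (r * Real.log y)) (by
        refine Real.continuous_exp.comp_continuousOn (continuousOn_const.mul
          (Real.continuousOn_log.mono fun y hy => ?_))
        exact (hδ.trans_le hy.1).ne')
    exact ⟨C, fun x => hC _ ⟨hgδ x, hM x⟩⟩
  set h : E → ℝ := fun x => Real.exp (q / 2 * Real.log (g x))
  set H : E → ℝ := fun x => q / 2 * Real.exp ((q / 2 - 1) * Real.log (g x)) * G x
  have hLB : LocalLipBound h H := by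
    have := hg.comp (φ := fun y => Real.exp (q / 2 * Real.log y))
      (φ' := fun y => Real.exp (q / 2 * Real.log y) * (q / 2 * y⁻¹)) hc
      (fun x => Real.contDiff_exp.contDiffAt.comp _
        (contDiffAt_const.mul (Real.contDiffAt_log.2 (hpos x).ne')))
      (fun x => ((Real.hasDerivAt_log (hpos x).ne').const_mul _).exp)
    refine this.mono fun x => le_of_eq ?_
    rw [abs_of_nonneg (by have := hpos x; positivity)]
    simp only [H]
    rw [sub_mul, one_mul, Real.exp_sub, Real.exp_log (hpos x)]
    ring
  have hH0 (x : E) : 0 ≤ H x := by have := hG x; positivity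
  have hHc : Continuous H := by fun_prop
  have hG2 : MemLp G 2 ν := hGq.mono_exponent (by simpa using ENNReal.ofReal_le_ofReal hq.le)
  obtain ⟨C, hC⟩ := hbd (q / 2 - 1)
  have hH2 : MemLp H 2 ν := by
    refine hG2.of_le_mul (c := q / 2 * C) hHc.aestronglyMeasurable (.of_forall fun x => ?_)
    rw [norm_mul, norm_mul, Real.norm_of_nonneg (by positivity : 0 ≤ q / 2)]
    gcongr
    exact hC x
  obtain ⟨C', hC'⟩ := hbd (q / 2)
  have hent := hν.of_bounded hs hLB hH0 hHc hH2 hC'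
  have hsq : (fun x => h x ^ 2) = fun x => Real.exp (q * Real.log (g x)) := by
    ext x
    simp only [h]
    rw [← Real.exp_nat_mul]
    push_cast
    congr 1; ring
  rw [hsq] at hent
  refine hent.trans (mul_le_mul_of_nonneg_left ?_ (by positivity))
  have hHsq (x : E) : H x ^ 2 = q ^ 2 / 4 * (Real.exp ((q - 2) * Real.log (g x)) * G x ^ 2) := by
    simp only [H]
    rw [mul_pow, mul_pow, ← Real.exp_nat_mul]
    push_cast
    rw [show 2 * ((q / 2 - 1) * Real.log (g x)) = (q - 2) * Real.log (g x) by ring]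
    ring
  simp_rw [hHsq]
  rw [integral_const_mul]
  refine mul_le_mul_of_nonneg_left ?_ (by positivity)
  obtain ⟨D, hD⟩ := hbd (q - 2)
  have hq2 : 0 < q - 2 := by linarith
  have hconj : (q / (q - 2)).HolderConjugate (q / 2) := by
    rw [Real.holderConjugate_iff]
    refine ⟨by rw [lt_div_iff₀ hq2]; linarith, ?_⟩
    field_simp
    ring
  have hGq' : MemLp (fun x => G x ^ 2) (ENNReal.ofReal (q / 2)) ν := by
    have := hGq.norm_rpow_div 2
    rw [ENNReal.ofReal_div_of_pos two_pos]
    simpa using this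
  have hold := integral_mul_le_Lp_mul_Lq_of_nonneg hconj
    (f := fun x => Real.exp ((q - 2) * Real.log (g x))) (g := fun x => G x ^ 2) (μ := ν)
    (.of_forall fun x => (Real.exp_pos _).le) (.of_forall fun x => sq_nonneg _)
    (.of_bound (Continuous.aestronglyMeasurable (by fun_prop)) D (.of_forall hD)) hGq'
  refine hold.trans (le_of_eq ?_)
  congr 1
  · congr 1
    · refine integral_congr_ae (.of_forall fun x => ?_)
      simp only
      rw [← Real.exp_mul]
      congr 1
      field_simp
    · field_simp
  · rw [lpNorm_ofReal_eq (by linarith) hGq.1, ← Real.rpow_natCast, ← Real.rpow_mul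
      (integral_nonneg fun x => by positivity)]
    congr 1
    · refine integral_congr_ae (.of_forall fun x => ?_)
      simp only
      rw [← Real.rpow_natCast, ← Real.rpow_mul (hG x), abs_of_nonneg (hG x)]
      congr 1
      push_cast
      ring
    · push_cast
      field_simp

open ProbabilityTheory in
/-- The moment growth for functions bounded away from `0` and `∞`. -/
theorem LogSobolev.lpNorm_sq_le_of_bounded (hν : LogSobolev ν s) (hs : 0 ≤ s)
    (hg : LocalLipBound g G) (hG : ∀ x, 0 ≤ G x) (hGc : Continuous G) {δ p : ℝ} (hδ : 0 < δ)
    (hgδ : ∀ x, δ ≤ g x) (hM : ∀ x, g x ≤ M) (hp : 2 ≤ p) (hGp : MemLp G (ENNReal.ofReal p) ν) :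
    lpNorm g (ENNReal.ofReal p) ν ^ 2 ≤
      lpNorm g 2 ν ^ 2 + s * (p - 2) * lpNorm G (ENNReal.ofReal p) ν ^ 2 := by
  have hc := hg.continuous
  have hpos (x : E) : 0 < g x := hδ.trans_le (hgδ x)
  have hlc : Continuous fun x => Real.log (g x) := hc.log fun x => (hpos x).ne'
  set X : E → ℝ := fun x => Real.log (g x)
  have hexp (q : ℝ) : Integrable (fun x => Real.exp (q * X x)) ν :=
    integrable_exp_mul_of_mem_Icc (a := Real.log δ) (b := Real.log M) hlc.aemeasurable
      (.of_forall fun x => ⟨Real.log_le_log hδ (hgδ x), Real.log_le_log (hpos x) (hM x)⟩)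
  have hset : integrableExpSet X ν = Set.univ := Set.eq_univ_of_forall hexp
  have hmpos (q : ℝ) : 0 < mgf X ν q := mgf_pos (hexp q)
  have hmder (q : ℝ) : HasDerivAt (mgf X ν) (∫ x, X x * Real.exp (q * X x) ∂ν) q :=
    hasDerivAt_mgf (by simp [hset])
  have hnorm {q : ℝ} (hq : 0 < q) :
      lpNorm g (ENNReal.ofReal q) ν ^ 2 = Real.exp (2 / q * Real.log (mgf X ν q)) := by
    rw [lpNorm_ofReal_eq hq hc.aestronglyMeasurable, mul_comm, Real.exp_mul,
      Real.exp_log (hmpos q), ← Real.rpow_natCast, ← Real.rpow_mul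
        (integral_nonneg fun x => by positivity)]
    congr 1
    · refine integral_congr_ae (.of_forall fun x => ?_)
      simp only [X]
      rw [abs_of_pos (hpos x), Real.rpow_def_of_pos (hpos x), mul_comm]
    · push_cast; ring
  have h2 : lpNorm g 2 ν ^ 2 = Real.exp (2 / 2 * Real.log (mgf X ν 2)) := by
    rw [← hnorm two_pos]; simp
  have hder {q : ℝ} (hq : 0 < q) :
      HasDerivAt (fun q => Real.exp (2 / q * Real.log (mgf X ν q)))
        (Real.exp (2 / q * Real.log (mgf X ν q)) * (2 / (q ^ 2 * mgf X ν q)) *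
          relEntropy ν (fun x => Real.exp (q * X x))) q := by
    have := (((hasDerivAt_inv hq.ne').const_mul 2).mul ((hmder q).log (hmpos q).ne')).exp
    convert! this using 1
    have hent : relEntropy ν (fun x => Real.exp (q * X x)) =
        q * (∫ x, X x * Real.exp (q * X x) ∂ν) - mgf X ν q * Real.log (mgf X ν q) := by
      simp only [relEntropy, Real.log_exp, mgf]
      congr 1
      rw [← integral_const_mul]
      refine integral_congr_ae (.of_forall fun x => ?_)
      simp only
      ring
    rw [hent]
    have := (hmpos q).ne'
    simp only [Pi.mul_apply]
    field_simp
    ring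
  set B := lpNorm G (ENNReal.ofReal p) ν
  rw [h2, hnorm (by linarith)]
  have hle := (convex_Icc 2 p).image_sub_le_mul_sub_of_deriv_le (C := s * B ^ 2)
    (fun q hq => (hder (by linarith [hq.1])).continuousAt.continuousWithinAt)
    (fun q hq => by
      rw [interior_Icc] at hq
      exact (hder (by linarith [hq.1])).differentiableAt.differentiableWithinAt)
    (fun q hq => by
      rw [interior_Icc] at hq
      have hq0 : 0 < q := by linarith [hq.1]
      rw [(hder hq0).deriv]
      have hqp : ENNReal.ofReal q ≤ ENNReal.ofReal p := ENNReal.ofReal_le_ofReal hq.2.le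
      have hent := hν.relEntropy_exp_le hs hg hG hGc hδ hgδ hM hq.1 (hGp.mono_exponent hqp)
      have hB : lpNorm G (ENNReal.ofReal q) ν ^ 2 ≤ B ^ 2 :=
        pow_le_pow_left₀ lpNorm_nonneg (lpNorm_mono_exponent hqp hGp) 2
      have hm := hmpos q
      calc _ ≤ Real.exp (2 / q * Real.log (mgf X ν q)) * (2 / (q ^ 2 * mgf X ν q)) *
            (2 * s * (q ^ 2 / 4 * (mgf X ν q ^ (1 - 2 / q) * B ^ 2))) := by
            gcongr
            refine hent.trans ?_
            have := Real.rpow_nonneg hm.le (1 - 2 / q)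
            rw [mgf] at this ⊢
            gcongr
        _ = s * B ^ 2 := by
          rw [Real.rpow_def_of_pos hm, mul_sub, mul_one, Real.exp_sub, Real.exp_log hm,
            mul_comm (Real.log _)]
          field_simp
          ring)
    2 (Set.left_mem_Icc.2 hp) p (Set.right_mem_Icc.2 hp) hp
  linarith

end Moments

section UnboundedMoments

variable {E : Type*} [NormedAddCommGroup E] [NormedSpace ℝ E] [FiniteDimensional ℝ E]
  [MeasurableSpace E] [BorelSpace E] {g G : E → ℝ}
  {ν : Measure E} [IsProbabilityMeasure ν] {s : ℝ}

/-- The moment growth implied by a logarithmic Sobolev inequality. -/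
theorem LogSobolev.lpNorm_sq_le (hν : LogSobolev ν s) (hs : 0 ≤ s)
    (hg : LocalLipBound g G) (hG : ∀ x, 0 ≤ G x) (hGc : Continuous G) {p : ℝ}
    (hp : 2 ≤ p) (hg2 : MemLp g 2 ν) (hGp : MemLp G (ENNReal.ofReal p) ν) :
    MemLp g (ENNReal.ofReal p) ν ∧ lpNorm g (ENNReal.ofReal p) ν ^ 2 ≤
      lpNorm g 2 ν ^ 2 + s * (p - 2) * lpNorm G (ENNReal.ofReal p) ν ^ 2 := by
  have hc := hg.continuous
  set B := s * (p - 2) * lpNorm G (ENNReal.ofReal p) ν ^ 2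
  have hB : 0 ≤ B := mul_nonneg (mul_nonneg hs (by linarith)) (sq_nonneg _)
  let u : ℕ → E → ℝ := fun m x => min |g x| m + 1 / ((m : ℝ) + 1)
  have huc (m : ℕ) : Continuous (u m) := by fun_prop
  have hδ (m : ℕ) : (0 : ℝ) < 1 / ((m : ℝ) + 1) := by positivity
  have hulip (m : ℕ) : LocalLipBound (u m) G := by
    refine hg.of_abs_sub_le fun y z => ?_
    simp only [u, add_sub_add_right_eq_sub]
    refine (abs_min_sub_min_le_max |g y| m |g z| m).trans ?_
    simpa using abs_abs_sub_abs_le (g y) (g z)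
  have hulow (m : ℕ) (x : E) : 1 / ((m : ℝ) + 1) ≤ u m x := by
    have : 0 ≤ min |g x| (m : ℝ) := by positivity
    simp only [u]; linarith
  have huup (m : ℕ) (x : E) : u m x ≤ m + 1 / ((m : ℝ) + 1) := by
    simp only [u]; gcongr; exact min_le_right _ _
  have hu2 (m : ℕ) : lpNorm (u m) 2 ν ≤ lpNorm g 2 ν + 1 / ((m : ℝ) + 1) := by
    have h1 : lpNorm (u m) 2 ν ≤ lpNorm ((fun x => |g x|) + fun _ => 1 / ((m : ℝ) + 1)) 2 ν := by
      refine lpNorm_mono_real (hg2.abs.add (memLp_const _)) fun x => ?_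
      rw [Real.norm_of_nonneg ((hδ m).le.trans (hulow m x))]
      simp only [u, Pi.add_apply]
      gcongr
      exact min_le_left _ _
    refine h1.trans ((lpNorm_add_le hg2.abs (by norm_num)).trans_eq ?_)
    congr 1
    · exact lpNorm_abs hg2.1 2
    · rw [lpNorm_const' (by norm_num) (by norm_num), Real.norm_of_nonneg (hδ m).le]
      simp
  have hup (m : ℕ) : lpNorm (u m) (ENNReal.ofReal p) ν ≤
      Real.sqrt ((lpNorm g 2 ν + 1 / ((m : ℝ) + 1)) ^ 2 + B) := by
    refine Real.le_sqrt_of_sq_le ?_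
    refine (hν.lpNorm_sq_le_of_bounded hs (hulip m) hG hGc (hδ m) (hulow m) (huup m) hp
      hGp).trans ?_
    gcongr
    · exact lpNorm_nonneg
    · exact hu2 m
  have h0 : Tendsto (fun m : ℕ => 1 / ((m : ℝ) + 1)) atTop (𝓝 0) :=
    tendsto_one_div_add_atTop_nhds_zero_nat
  have hlim (x : E) : Tendsto (fun m => u m x) atTop (𝓝 |g x|) := by
    have : Tendsto (fun m : ℕ => min |g x| (m : ℝ)) atTop (𝓝 |g x|) := by
      refine tendsto_const_nhds.congr' ?_
      obtain ⟨m₀, hm₀⟩ := exists_nat_ge |g x|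
      filter_upwards [eventually_ge_atTop m₀] with m hm
      rw [min_eq_left (hm₀.trans (by exact_mod_cast hm))]
    simpa [u] using this.add h0
  have hC : Tendsto (fun m : ℕ => Real.sqrt ((lpNorm g 2 ν + 1 / ((m : ℝ) + 1)) ^ 2 + B)) atTop
      (𝓝 (Real.sqrt (lpNorm g 2 ν ^ 2 + B))) := by
    have := (((h0.const_add (lpNorm g 2 ν)).pow 2).add_const B).sqrt
    simpa using this
  have huM (m : ℕ) : MemLp (u m) (ENNReal.ofReal p) ν :=
    .of_bound (huc m).aestronglyMeasurable (m + 1 / ((m : ℝ) + 1)) (.of_forall fun x => by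
      rw [Real.norm_of_nonneg ((hδ m).le.trans (hulow m x))]
      exact huup m x)
  obtain ⟨hM, hle⟩ := memLp_of_tendsto huM hlim hup hC
  have hgM : MemLp g (ENNReal.ofReal p) ν :=
    hM.of_le hc.aestronglyMeasurable (.of_forall fun x => by simp)
  refine ⟨hgM, ?_⟩
  rw [lpNorm_fun_abs hgM.1] at hle
  calc _ ≤ Real.sqrt (lpNorm g 2 ν ^ 2 + B) ^ 2 := pow_le_pow_left₀ lpNorm_nonneg hle 2
    _ = _ := Real.sq_sqrt (by positivity)

end UnboundedMoments

section ExponentialMoments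

/-- Iterating the moment inequality along a chain of functions, each controlling the local
Lipschitz constants of the previous one. -/
theorem LogSobolev.lpNorm_sq_le_of_chain {E : Type*} [NormedAddCommGroup E] [NormedSpace ℝ E]
    [FiniteDimensional ℝ E] [MeasurableSpace E] [BorelSpace E] {ν : Measure E}
    [IsProbabilityMeasure ν] {s : ℝ} (hν : LogSobolev ν s) (hs : 0 ≤ s) {d : ℕ} {G : ℕ → E → ℝ}
    (hG : ∀ k x, 0 ≤ G k x) (hGc : ∀ k ≤ d, Continuous (G k))
    (hlip : ∀ k < d, LocalLipBound (G k) (G (k + 1))) (hG2 : ∀ k ≤ d, MemLp (G k) 2 ν)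
    (hle : ∀ m ≤ d, ∫ x, G (d - m) x ^ 2 ∂ν ≤ s ^ m) (hGd : ∀ᵐ x ∂ν, G d x ≤ 1)
    {p : ℝ} (hp : 2 ≤ p) {m : ℕ} (hm : m ≤ d) :
    MemLp (G (d - m)) (ENNReal.ofReal p) ν ∧
      lpNorm (G (d - m)) (ENNReal.ofReal p) ν ^ 2 ≤ (s * (p - 1)) ^ m := by
  induction m with
  | zero =>
    have hb : ∀ᵐ x ∂ν, ‖G d x‖ ≤ 1 := by
      filter_upwards [hGd] with x hx
      rwa [Real.norm_of_nonneg (hG d x)]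
    have hM : MemLp (G d) (ENNReal.ofReal p) ν :=
      .of_bound (hGc d le_rfl).aestronglyMeasurable 1 hb
    refine ⟨hM, ?_⟩
    rw [Nat.sub_zero, pow_zero, ← toReal_eLpNorm hM.1]
    have h1 : eLpNorm (G d) (ENNReal.ofReal p) ν ≤ 1 := by
      simpa using eLpNorm_le_of_ae_bound (p := ENNReal.ofReal p) hb
    refine pow_le_one₀ ENNReal.toReal_nonneg (ENNReal.toReal_le_of_le_ofReal zero_le_one ?_)
    simpa using h1
  | succ m ih =>
    obtain ⟨ihM, ihle⟩ := ih (Nat.le_of_succ_le hm)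
    have hsucc : d - (m + 1) + 1 = d - m := by omega
    have hL := hlip (d - (m + 1)) (by omega)
    rw [hsucc] at hL
    obtain ⟨hM, hN⟩ := hν.lpNorm_sq_le hs hL (hG _) (hGc _ (by omega)) hp (hG2 _ (by omega)) ihM
    refine ⟨hM, hN.trans ?_⟩
    rw [lpNorm_two_sq (hGc _ (by omega)).aestronglyMeasurable]
    have hp2 : 0 ≤ p - 2 := by linarith
    calc _ ≤ s ^ (m + 1) + s * (p - 2) * (s * (p - 1)) ^ m := by
          gcongr
          exact hle _ hm
      _ = s ^ (m + 1) * (1 + (p - 2) * (p - 1) ^ m) := by rw [mul_pow]; ring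
      _ ≤ s ^ (m + 1) * (p - 1) ^ (m + 1) := by
          have : 1 ≤ (p - 1) ^ m := one_le_pow₀ (by linarith)
          gcongr
          rw [pow_succ]
          linarith
      _ = _ := (mul_pow _ _ _).symm

/-- Exponential integrability from moment growth. -/
theorem integral_exp_rpow_le_two {Ω : Type*} [MeasurableSpace Ω] {μ : Measure Ω}
    [IsProbabilityMeasure μ] {F : Ω → ℝ} {s : ℝ} (hs : 0 < s) {d : ℕ} (hd : 1 ≤ d)
    (hF : ∀ p : ℝ, 2 ≤ p → MemLp F (ENNReal.ofReal p) μ ∧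
      lpNorm F (ENNReal.ofReal p) μ ^ 2 ≤ (s * (p - 1)) ^ d) :
    ∫ x, Real.exp (1 / (8 * Real.exp 1) / s * |F x| ^ ((2 : ℝ) / d)) ∂μ ≤ 2 := by
  set c : ℝ := 1 / (8 * Real.exp 1) / s with hcdef
  have hc : 0 < c := by positivity
  have hd0 : (0 : ℝ) < d := by exact_mod_cast hd
  set u : ℕ → Ω → ℝ := fun k x => (c * |F x| ^ ((2 : ℝ) / d)) ^ k / k.factorial
  have hu0 (k : ℕ) (x : Ω) : 0 ≤ u k x := by positivity
  have hterm (k : ℕ) : Integrable (u k) μ ∧ ∫ x, u k x ∂μ ≤ (1 / 4) ^ k := by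
    rcases k.eq_zero_or_pos with rfl | hk
    · simp [u]
    have hk1 : (1 : ℝ) ≤ k := by exact_mod_cast hk
    set q : ℝ := 2 / d * k
    have hq : 0 < q := by positivity
    have hq2k : q ≤ 2 * k := by
      have : (2 : ℝ) / d ≤ 2 := div_le_self zero_le_two (by exact_mod_cast hd)
      exact mul_le_mul_of_nonneg_right this k.cast_nonneg
    obtain ⟨hM, hN⟩ := hF (max q 2) (le_max_right _ _)
    have hqm : ENNReal.ofReal q ≤ ENNReal.ofReal (max q 2) :=
      ENNReal.ofReal_le_ofReal (le_max_left _ _)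
    have hMq := hM.mono_exponent hqm
    have hueq : u k = fun x => c ^ k / k.factorial * |F x| ^ q := by
      ext x
      simp only [u, q]
      rw [mul_pow, Real.rpow_mul (abs_nonneg _), Real.rpow_natCast]
      ring
    have hint : Integrable (fun x => |F x| ^ q) μ := by
      have := hMq.integrable_norm_rpow (by simpa using hq) (by simp)
      simpa [ENNReal.toReal_ofReal hq.le] using this
    have hI0 : 0 ≤ ∫ x, |F x| ^ q ∂μ := integral_nonneg fun x => by positivity
    have hmom : ∫ x, |F x| ^ q ∂μ ≤ (2 * k * s) ^ k := by
      have h1 : lpNorm F (ENNReal.ofReal q) μ ^ 2 ≤ (2 * k * s) ^ d := by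
        refine (pow_le_pow_left₀ lpNorm_nonneg (lpNorm_mono_exponent hqm hM) 2).trans
          (hN.trans ?_)
        have h2 : max q 2 - 1 ≤ 2 * k := by
          have := max_le hq2k (by linarith : (2 : ℝ) ≤ 2 * k)
          linarith
        have h3 : 0 ≤ max q 2 - 1 := by linarith [le_max_right q 2]
        calc _ ≤ (s * (2 * k)) ^ d := by gcongr
          _ = _ := by ring
      rw [lpNorm_ofReal_eq hq hMq.1] at h1
      calc ∫ x, |F x| ^ q ∂μ = (((∫ x, |F x| ^ q ∂μ) ^ (1 / q)) ^ 2) ^ ((k : ℝ) / d) := by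
            rw [← Real.rpow_natCast, ← Real.rpow_mul hI0, ← Real.rpow_mul hI0]
            rw [show 1 / q * ((2 : ℕ) : ℝ) * (k / d) = 1 by simp only [q]; push_cast; field_simp,
              Real.rpow_one]
        _ ≤ ((2 * k * s) ^ d) ^ ((k : ℝ) / d) := by gcongr
        _ = (2 * k * s) ^ k := by
            rw [← Real.rpow_natCast, ← Real.rpow_mul (by positivity), mul_div_cancel₀ _ hd0.ne',
              Real.rpow_natCast]
    rw [hueq]
    refine ⟨hint.const_mul _, ?_⟩
    rw [integral_const_mul]
    have hfac := Real.pow_div_factorial_le_exp (k : ℝ) k.cast_nonneg k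
    calc _ ≤ c ^ k / k.factorial * (2 * k * s) ^ k := by gcongr
      _ = (2 * c * s) ^ k * ((k : ℝ) ^ k / k.factorial) := by simp only [mul_pow]; ring
      _ ≤ (2 * c * s) ^ k * Real.exp k := by gcongr
      _ = (1 / 4) ^ k := by
        rw [← Real.exp_one_pow, ← mul_pow, hcdef]
        congr 1
        field_simp
        norm_num
  have hgeom : HasSum (fun k : ℕ => (1 / 4 : ℝ) ^ k) (1 - 1 / 4)⁻¹ :=
    hasSum_geometric_of_lt_one (by norm_num) (by norm_num)
  have hsum : Summable fun k => ∫ x, ‖u k x‖ ∂μ := by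
    refine Summable.of_nonneg_of_le (fun k => by positivity) (fun k => ?_) hgeom.summable
    simp_rw [Real.norm_of_nonneg (hu0 k _)]
    exact (hterm k).2
  have hexp := hasSum_integral_of_summable_integral_norm (fun k => (hterm k).1) hsum
  have heq (x : Ω) : ∑' k, u k x = Real.exp (c * |F x| ^ ((2 : ℝ) / d)) := by
    rw [Real.exp_eq_exp_ℝ, NormedSpace.exp_eq_tsum_div]
  simp_rw [heq] at hexp
  refine (hasSum_le (fun k => (hterm k).2) hexp hgeom).trans (by norm_num)

end ExponentialMoments

section Derivatives

variable {ι E : Type*} [Fintype ι] [NormedAddCommGroup E] [InnerProductSpace ℝ E]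

/-- The operator norm of a multilinear form is at most its Hilbert-Schmidt norm. -/
theorem ContinuousMultilinearMap.norm_sq_le_sum_sq [DecidableEq ι] (b : OrthonormalBasis ι ℝ E)
    {k : ℕ} (T : ContinuousMultilinearMap ℝ (fun _ : Fin k => E) ℝ) :
    ‖T‖ ^ 2 ≤ ∑ I : Fin k → ι, T (fun j => b (I j)) ^ 2 := by
  refine (Real.le_sqrt (norm_nonneg _) (by positivity)).1 (T.opNorm_le_bound (by positivity)
    fun v => ?_)
  have hexp : T v = ∑ I : Fin k → ι, (∏ j, inner ℝ (b (I j)) (v j)) * T (fun j => b (I j)) := by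
    conv_lhs => rw [show v = fun j => ∑ i, inner ℝ (b i) (v j) • b i from
      funext fun j => (b.sum_repr' (v j)).symm]
    rw [T.map_sum]
    exact Finset.sum_congr rfl fun I _ => by rw [T.map_smul_univ, smul_eq_mul]
  have hprod : ∑ I : Fin k → ι, (∏ j, inner ℝ (b (I j)) (v j)) ^ 2 = (∏ j, ‖v j‖) ^ 2 := by
    simp_rw [← Finset.prod_pow]
    rw [← Fintype.prod_sum fun j i => inner ℝ (b i) (v j) ^ 2]
    refine Finset.prod_congr rfl fun j _ => ?_
    rw [← b.sum_sq_norm_inner_right (v j)]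
    simp
  rw [← abs_of_nonneg (Finset.prod_nonneg fun j _ => norm_nonneg (v j)), ← Real.sqrt_sq_eq_abs,
    ← Real.sqrt_mul (by positivity), Real.norm_eq_abs, ← Real.sqrt_sq_eq_abs, ← hprod, hexp,
    mul_comm]
  exact Real.sqrt_le_sqrt (Finset.sum_mul_sq_le_sq_mul_sq _ _ _)

theorem ContinuousLinearMap.norm_sq_eq_sum_sq [FiniteDimensional ℝ E] (b : OrthonormalBasis ι ℝ E)
    (L : E →L[ℝ] ℝ) : ‖L‖ ^ 2 = ∑ i, L (b i) ^ 2 := by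
  rw [← (InnerProductSpace.toDual ℝ E).symm.norm_map, ← b.sum_sq_norm_inner_left]
  simp [InnerProductSpace.toDual_symm_apply]

variable {F : E → ℝ} {d k : ℕ}

theorem fderiv_iteratedFDeriv_apply_const (hF : ContDiff ℝ d F) (hk : k < d) (v : Fin k → E)
    (x w : E) : fderiv ℝ (fun y => iteratedFDeriv ℝ k F y v) x w =
      iteratedFDeriv ℝ (k + 1) F x (Fin.cons w v) := by
  have hdiff : DifferentiableAt ℝ (iteratedFDeriv ℝ k F) x :=
    hF.differentiable_iteratedFDeriv (by exact_mod_cast hk) x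
  rw [iteratedFDeriv_succ_apply_left, Fin.cons_zero, Fin.tail_cons]
  have := ((ContinuousMultilinearMap.apply ℝ (fun _ : Fin k => E) ℝ v).hasFDerivAt.comp x
    hdiff.hasFDerivAt).fderiv
  exact congrArg (fun L : E →L[ℝ] ℝ => L w) this

theorem sum_norm_sq_fderiv_iteratedFDeriv [FiniteDimensional ℝ E] (b : OrthonormalBasis ι ℝ E)
    (hF : ContDiff ℝ d F) (hk : k < d) (x : E) :
    ∑ I : Fin k → ι, ‖fderiv ℝ (fun y => iteratedFDeriv ℝ k F y fun j => b (I j)) x‖ ^ 2 =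
      ∑ I : Fin (k + 1) → ι, iteratedFDeriv ℝ (k + 1) F x (fun j => b (I j)) ^ 2 := by
  simp_rw [ContinuousLinearMap.norm_sq_eq_sum_sq b, fderiv_iteratedFDeriv_apply_const hF hk]
  rw [Finset.sum_comm, ← (Fin.consEquiv fun _ => ι).sum_comp, Fintype.sum_prod_type]
  refine Finset.sum_congr rfl fun i _ => Finset.sum_congr rfl fun I _ => ?_
  congr 2
  ext j
  refine Fin.cases ?_ (fun j => ?_) j <;> simp [Fin.consEquiv]

end Derivatives

section HigherOrder

variable {ι E : Type*} [Fintype ι] [NormedAddCommGroup E] [InnerProductSpace ℝ E]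
  [FiniteDimensional ℝ E] [MeasurableSpace E] [BorelSpace E] {ν : Measure E}
  [IsProbabilityMeasure ν] {s : ℝ} {F : E → ℝ} {d : ℕ}

/-- The iterated Poincaré inequality for functions all of whose derivatives of order `< d` are
centered. -/
theorem LogSobolev.sum_integral_sq_iteratedFDeriv_le [DecidableEq ι] (hν : LogSobolev ν s)
    (hs : 0 ≤ s) (b : OrthonormalBasis ι ℝ E) (hF : ContDiff ℝ d F)
    (hmean : ∀ k < d, ∀ I : Fin k → ι, ∫ x, iteratedFDeriv ℝ k F x (fun j => b (I j)) ∂ν = 0)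
    (hmem : ∀ I : Fin d → ι, MemLp (fun x => iteratedFDeriv ℝ d F x fun j => b (I j)) 2 ν)
    (hle : ∑ I : Fin d → ι, ∫ x, iteratedFDeriv ℝ d F x (fun j => b (I j)) ^ 2 ∂ν ≤ 1)
    {m : ℕ} (hm : m ≤ d) :
    (∀ I : Fin (d - m) → ι,
      MemLp (fun x => iteratedFDeriv ℝ (d - m) F x fun j => b (I j)) 2 ν) ∧
    ∑ I : Fin (d - m) → ι, ∫ x, iteratedFDeriv ℝ (d - m) F x (fun j => b (I j)) ^ 2 ∂ν
      ≤ s ^ m := by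
  induction m with
  | zero => exact ⟨hmem, by simpa using hle⟩
  | succ m ih =>
    obtain ⟨ihM, ihle⟩ := ih (Nat.le_of_succ_le hm)
    have hk : d - (m + 1) < d := by omega
    rw [show d - m = d - (m + 1) + 1 by omega] at ihM ihle
    generalize d - (m + 1) = k at hk ihM ihle ⊢
    set c : (Fin k → ι) → E → ℝ := fun I x => iteratedFDeriv ℝ k F x fun j => b (I j)
    have hcd (I : Fin k → ι) : ContDiff ℝ 1 (c I) :=
      (ContinuousMultilinearMap.apply ℝ (fun _ : Fin k => E) ℝ fun j => b (I j)).contDiff.comp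
        (hF.iteratedFDeriv_right (m := 1) (by norm_cast; omega))
    have hGc (I : Fin k → ι) : Continuous fun x => ‖fderiv ℝ (c I) x‖ :=
      ((hcd I).continuous_fderiv one_ne_zero).norm
    have hsum := sum_norm_sq_fderiv_iteratedFDeriv b hF hk
    have hint : Integrable (fun x => ∑ I : Fin (k + 1) → ι,
        iteratedFDeriv ℝ (k + 1) F x (fun j => b (I j)) ^ 2) ν :=
      integrable_finsetSum _ fun I _ => (ihM I).integrable_sq
    have hG2 (I : Fin k → ι) : MemLp (fun x => ‖fderiv ℝ (c I) x‖) 2 ν := by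
      rw [memLp_two_iff_integrable_sq (hGc I).aestronglyMeasurable]
      refine hint.mono' ((hGc I).pow 2).aestronglyMeasurable (.of_forall fun x => ?_)
      rw [← hsum x, Real.norm_of_nonneg (sq_nonneg _)]
      exact Finset.single_le_sum (f := fun I => ‖fderiv ℝ (c I) x‖ ^ 2)
        (fun _ _ => sq_nonneg _) (Finset.mem_univ I)
    have hP (I : Fin k → ι) := hν.poincare hs
      (LocalLipBound.of_contDiffAt_real fun x => (hcd I).contDiffAt) (fun x => norm_nonneg _)
      (hGc I) (hG2 I)
    refine ⟨fun I => (hP I).1, ?_⟩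
    calc _ ≤ ∑ I : Fin k → ι, s * ∫ x, ‖fderiv ℝ (c I) x‖ ^ 2 ∂ν :=
          Finset.sum_le_sum fun I _ => (hP I).2 (hmean k hk I)
      _ = s * ∑ I : Fin (k + 1) → ι,
            ∫ x, iteratedFDeriv ℝ (k + 1) F x (fun j => b (I j)) ^ 2 ∂ν := by
          rw [← Finset.mul_sum, ← integral_finsetSum _ fun I _ => (hG2 I).integrable_sq,
            ← integral_finsetSum _ fun I _ => (ihM I).integrable_sq]
          simp_rw [← hsum]
          rfl
      _ ≤ s * s ^ m := by gcongr
      _ = _ := (pow_succ' _ _).symm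

/-- Higher order concentration on a Euclidean space. -/
theorem LogSobolev.integral_exp_le_two [DecidableEq ι] (hν : LogSobolev ν s) (hs : 0 < s)
    (b : OrthonormalBasis ι ℝ E) (hd : 1 ≤ d) (hF : ContDiff ℝ d F)
    (hmean : ∀ k < d, ∀ I : Fin k → ι, ∫ x, iteratedFDeriv ℝ k F x (fun j => b (I j)) ∂ν = 0)
    (hle : ∑ I : Fin d → ι, ∫ x, iteratedFDeriv ℝ d F x (fun j => b (I j)) ^ 2 ∂ν ≤ 1)
    (hop : ∀ᵐ x ∂ν, ‖iteratedFDeriv ℝ d F x‖ ≤ 1) :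
    ∫ x, Real.exp (1 / (8 * Real.exp 1) / s * |F x| ^ ((2 : ℝ) / d)) ∂ν ≤ 2 := by
  have hcont (k : ℕ) (hk : k ≤ d) : Continuous (iteratedFDeriv ℝ k F) :=
    hF.continuous_iteratedFDeriv (by exact_mod_cast hk)
  have hccont (k : ℕ) (hk : k ≤ d) (I : Fin k → ι) :
      Continuous fun x => iteratedFDeriv ℝ k F x fun j => b (I j) :=
    (ContinuousMultilinearMap.apply ℝ (fun _ : Fin k => E) ℝ fun j => b (I j)).continuous.comp
      (hcont k hk)
  have hmem (I : Fin d → ι) : MemLp (fun x => iteratedFDeriv ℝ d F x fun j => b (I j)) 2 ν := by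
    refine .of_bound (hccont d le_rfl I).aestronglyMeasurable 1 ?_
    filter_upwards [hop] with x hx
    refine ((iteratedFDeriv ℝ d F x).le_opNorm _).trans ?_
    simpa using hx
  have hHS {m : ℕ} (hm : m ≤ d) :=
    hν.sum_integral_sq_iteratedFDeriv_le hs.le b hF hmean hmem hle hm
  have hint {m : ℕ} (hm : m ≤ d) : Integrable (fun x => ∑ I : Fin (d - m) → ι,
      iteratedFDeriv ℝ (d - m) F x (fun j => b (I j)) ^ 2) ν :=
    integrable_finsetSum _ fun I _ => ((hHS hm).1 I).integrable_sq
  have hnint {m : ℕ} (hm : m ≤ d) :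
      Integrable (fun x => ‖iteratedFDeriv ℝ (d - m) F x‖ ^ 2) ν := by
    refine (hint hm).mono' ((hcont _ (by omega)).norm.pow 2).aestronglyMeasurable
      (.of_forall fun x => ?_)
    rw [Real.norm_of_nonneg (sq_nonneg _)]
    exact (iteratedFDeriv ℝ (d - m) F x).norm_sq_le_sum_sq b
  refine integral_exp_rpow_le_two hs hd fun p hp => ?_
  have hchain := hν.lpNorm_sq_le_of_chain hs.le (d := d)
    (G := fun k x => ‖iteratedFDeriv ℝ k F x‖) (fun k x => norm_nonneg _)
    (fun k hk => (hcont k hk).norm)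
    (fun k hk => by
      refine (LocalLipBound.of_contDiffAt fun x => (hF.iteratedFDeriv_right (i := k) (m := 1)
        (by norm_cast; omega)).contDiffAt).mono fun x => ?_
      rw [norm_fderiv_iteratedFDeriv])
    (fun k hk => by
      rw [memLp_two_iff_integrable_sq (hcont k hk).norm.aestronglyMeasurable]
      have := hnint (Nat.sub_le d k)
      rwa [Nat.sub_sub_self hk] at this)
    (fun m hm => by
      refine le_trans ?_ (hHS hm).2
      rw [← integral_finsetSum _ fun I _ => ((hHS hm).1 I).integrable_sq]
      exact integral_mono (hnint hm) (hint hm)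
        fun x => (iteratedFDeriv ℝ (d - m) F x).norm_sq_le_sum_sq b)
    hop hp le_rfl
  rw [Nat.sub_self] at hchain
  simp only [norm_iteratedFDeriv_zero] at hchain
  have hFm := hF.continuous.aestronglyMeasurable (μ := ν)
  exact ⟨(memLp_norm_iff hFm).1 hchain.1, by simpa [lpNorm_fun_abs hFm] using hchain.2⟩

end HigherOrder

theorem ContinuousMultilinearMap.norm_le_one_of_forall_unit {E : Type*} [NormedAddCommGroup E]
    [NormedSpace ℝ E] {d : ℕ} (hd : 1 ≤ d) (T : ContinuousMultilinearMap ℝ (fun _ : Fin d => E) ℝ)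
    (hT : ∀ v : Fin d → E, (∀ j, ‖v j‖ = 1) → T v ≤ 1) : ‖T‖ ≤ 1 := by
  refine T.opNorm_le_bound zero_le_one fun v => ?_
  rw [one_mul]
  by_cases hv : ∃ j, v j = 0
  · obtain ⟨j, hj⟩ := hv
    rw [T.map_coord_zero j hj, norm_zero]
    positivity
  push Not at hv
  set w : Fin d → E := fun j => ‖v j‖⁻¹ • v j
  have hw (j : Fin d) : ‖w j‖ = 1 := by
    simp only [w, norm_smul, norm_inv, norm_norm]
    exact inv_mul_cancel₀ (norm_ne_zero_iff.2 (hv j))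
  have hvw : v = fun j => ‖v j‖ • w j := by
    ext1 j
    simp only [w]
    rw [smul_inv_smul₀ (norm_ne_zero_iff.2 (hv j))]
  let i : Fin d := ⟨0, hd⟩
  have hneg : -T w ≤ 1 := by
    have h := hT (Function.update w i (-w i)) fun j => by
      rcases eq_or_ne j i with rfl | hj
      · simpa using hw _
      · simpa [hj] using hw j
    have hn := T.toMultilinearMap.map_update_neg w i (w i)
    rw [Function.update_eq_self] at hn
    exact hn.symm.trans_le h
  have habs : |T w| ≤ 1 := abs_le'.2 ⟨hT w hw, hneg⟩
  conv_lhs => rw [hvw, T.map_smul_univ, norm_smul]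
  rw [Real.norm_of_nonneg (by positivity)]
  exact mul_le_of_le_one_right (by positivity) habs

section Transfer

variable {n : ℕ}

theorem iteratedFDeriv_comp_euclidean_equiv (f : (Fin n → ℝ) → ℝ) (k : ℕ) (x : Fin n → ℝ)
    (v : Fin k → EuclideanSpace ℝ (Fin n)) :
    iteratedFDeriv ℝ k (f ∘ EuclideanSpace.equiv (Fin n) ℝ)
      ((EuclideanSpace.equiv (Fin n) ℝ).symm x) v =
      iteratedFDeriv ℝ k f x fun j => EuclideanSpace.equiv (Fin n) ℝ (v j) := by
  have h := (EuclideanSpace.equiv (Fin n) ℝ).iteratedFDerivWithin_comp_right f (s := Set.univ)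
    uniqueDiffOn_univ (x := (EuclideanSpace.equiv (Fin n) ℝ).symm x) (Set.mem_univ _) k
  simp only [Set.preimage_univ, iteratedFDerivWithin_univ,
    ContinuousLinearEquiv.apply_symm_apply] at h
  rw [h]
  rfl

theorem LogSobolev.of_entropy {ν : Measure (Fin n → ℝ)} {s : ℝ}
    (h : ∀ g : (Fin n → ℝ) → ℝ, ContDiff ℝ (⊤ : ℕ∞) g → (∃ M : ℝ, ∀ x, |g x| ≤ M) →
      (∃ M : ℝ, ∀ x, ‖fderiv ℝ g x‖ ≤ M) →
      entropy ν (fun x => g x ^ 2) ≤ 2 * s * ∫ x, ∑ i, (pd i g x) ^ 2 ∂ν) :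
    LogSobolev (ν.map (EuclideanSpace.equiv (Fin n) ℝ).symm) s := by
  set e := (EuclideanSpace.equiv (Fin n) ℝ).symm
  have hmap (φ : EuclideanSpace ℝ (Fin n) → ℝ) : ∫ y, φ y ∂ν.map e = ∫ x, φ (e x) ∂ν :=
    e.toHomeomorph.measurableEmbedding.integral_map φ
  rintro g hg ⟨M, hM⟩ ⟨M', hM'⟩
  have hder (x : Fin n → ℝ) : fderiv ℝ (g ∘ e) x = (fderiv ℝ g (e x)).comp (e : _ →L[ℝ] _) :=
    e.comp_right_fderiv
  have hmain := h (g ∘ e) (hg.comp e.contDiff) ⟨M, fun x => hM (e x)⟩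
    ⟨M' * ‖(e : (Fin n → ℝ) →L[ℝ] EuclideanSpace ℝ (Fin n))‖, fun x => by
      rw [hder]
      refine (ContinuousLinearMap.opNorm_comp_le _ _).trans ?_
      gcongr
      exact hM' _⟩
  have hpd (x : Fin n → ℝ) : ∑ i, pd i (g ∘ e) x ^ 2 = ‖fderiv ℝ g (e x)‖ ^ 2 := by
    rw [ContinuousLinearMap.norm_sq_eq_sum_sq (EuclideanSpace.basisFun (Fin n) ℝ)]
    refine Finset.sum_congr rfl fun i _ => ?_
    rw [pd, hder, EuclideanSpace.basisFun_apply]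
    rfl
  simp_rw [hpd] at hmain
  rw [relEntropy, hmap, hmap, hmap]
  exact hmain

end Transfer

/-- Bobkov–Götze–Sambale higher-order concentration: if `ν` satisfies a logarithmic
Sobolev inequality with constant `σ²`, `f` is `C^d` with vanishing mean and vanishing
means of all partial derivatives of order `< d`, `‖f^{(d)}‖_{HS,2} ≤ 1` and
`|f^{(d)}|_{Op} ≤ 1` ν-a.e., then `∫ exp((c/σ²) |f|^{2/d}) dν ≤ 2`. -/
theorem bobkov_gotze_sambale :
    ∃ c : ℝ, 0 < c ∧
      ∀ n : ℕ, ∀ ν : Measure (Fin n → ℝ), IsProbabilityMeasure ν →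
      ∀ σsq : ℝ, 0 < σsq →
      (∀ g : (Fin n → ℝ) → ℝ, ContDiff ℝ (⊤ : ℕ∞) g → (∃ M : ℝ, ∀ x, |g x| ≤ M) →
        (∃ M : ℝ, ∀ x, ‖fderiv ℝ g x‖ ≤ M) →
        entropy ν (fun x => g x ^ 2) ≤ 2 * σsq * ∫ x, ∑ i, (pd i g x) ^ 2 ∂ν) →
      ∀ d : ℕ, 1 ≤ d → ∀ f : (Fin n → ℝ) → ℝ, ContDiff ℝ (d : ℕ∞) f →
      (∫ x, f x ∂ν) = 0 →
      (∀ k : ℕ, 1 ≤ k → k ≤ d - 1 → ∀ i : Fin k → Fin n,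
        (∫ x, pder k f i x ∂ν) = 0) →
      Real.sqrt (∫ x, ∑ i : Fin d → Fin n, (pder d f i x) ^ 2 ∂ν) ≤ 1 →
      (∀ᵐ x ∂ν, ∀ v : Fin d → (Fin n → ℝ),
        (∀ j, ∑ i, (v j i) ^ 2 = 1) → iteratedFDeriv ℝ d f x v ≤ 1) →
      ∫ x, Real.exp ((c / σsq) * |f x| ^ ((2 : ℝ) / d)) ∂ν ≤ 2 := by
  refine ⟨1 / (8 * Real.exp 1), by positivity, fun n ν _ σsq hσ hLS d hd f hf h0 hmean
    hHS hop => ?_⟩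
  set e := (EuclideanSpace.equiv (Fin n) ℝ).symm
  have he : MeasurableEmbedding e := e.toHomeomorph.measurableEmbedding
  have hprob : IsProbabilityMeasure (ν.map e) :=
    Measure.isProbabilityMeasure_map e.continuous.aemeasurable
  set F : EuclideanSpace ℝ (Fin n) → ℝ := f ∘ e.symm
  have hcomp (k : ℕ) (I : Fin k → Fin n) (x : Fin n → ℝ) :
      iteratedFDeriv ℝ k F (e x) (fun j => EuclideanSpace.basisFun (Fin n) ℝ (I j)) =
        pder k f I x := by
    refine (iteratedFDeriv_comp_euclidean_equiv f k x _).trans ?_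
    simp only [EuclideanSpace.basisFun_apply, pder]
    rfl
  have hopF : ∀ᵐ x ∂ν, ‖iteratedFDeriv ℝ d F (e x)‖ ≤ 1 := by
    filter_upwards [hop] with x hx
    refine ContinuousMultilinearMap.norm_le_one_of_forall_unit hd _ fun v hv => ?_
    refine (iteratedFDeriv_comp_euclidean_equiv f d x v).trans_le (hx _ fun j => ?_)
    have := EuclideanSpace.norm_sq_eq (v j)
    rw [hv j] at this
    simpa using this.symm
  have hint (I : Fin d → Fin n) : Integrable (fun x => pder d f I x ^ 2) ν := by
    have hc : Continuous (pder d f I) :=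
      (ContinuousMultilinearMap.apply ℝ (fun _ : Fin d => Fin n → ℝ) ℝ _).continuous.comp
        (hf.continuous_iteratedFDeriv le_rfl)
    refine .of_bound (hc.pow 2).aestronglyMeasurable 1 ?_
    filter_upwards [hopF] with x hx
    have hle := (iteratedFDeriv ℝ d F (e x)).le_opNorm
      fun j => EuclideanSpace.basisFun (Fin n) ℝ (I j)
    rw [hcomp] at hle
    rw [norm_pow]
    exact pow_le_one₀ (norm_nonneg _) (hle.trans (by simpa using hx))
  have hLSe : LogSobolev (ν.map e) σsq := .of_entropy hLS
  have hmain := hLSe.integral_exp_le_two hσ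
    (EuclideanSpace.basisFun (Fin n) ℝ) hd (F := F) (hf.comp e.symm.contDiff)
    (fun k hk I => by
      rw [he.integral_map]
      simp_rw [hcomp]
      rcases k.eq_zero_or_pos with rfl | hk0
      · simpa [pder] using h0
      · exact hmean k hk0 (by omega) I)
    (by
      simp only [he.integral_map, hcomp]
      rw [← integral_finsetSum _ fun I _ => hint I]
      exact Real.sqrt_le_one.1 hHS)
    (he.ae_map_iff.2 hopF)
  rw [he.integral_map] at hmain
  simpa [F] using hmain
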